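/- arXiv:2506.01573 — 5 statements merged into one kernel-verified Lean document; each statement's English description precedes it below -/
import Mathlib

section
/- Let (X, ‖·‖_X) be a Banach space, let B : X × X → X be a continuous bilinear operator with ‖B(x,y)‖_X ≤ K₂‖x‖_X‖y‖_X, let T : X × X × X → X be a continuous trilinear operator with ‖T(x,y,z)‖_X ≤ K₃‖x‖_X‖y‖_X‖z‖_X, and let L : X → X be a continuous linear operator with operator norm N < 1. Then for every y ∈ X with ‖y‖_X < min( (1−N)/2 , (1−N)²/(2(2K₂+3K₃)) ), the equation x = y + L(x) + B(x,x) + T(x,x,x) has a unique solution x in the closed ball of center 0 and radius R̃ = min(1, (1−N)/(2K₂+3K₃)); moreover this solution satisfies ‖x‖_X ≤ (2/(1−N))‖y‖_X. -/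
open Metric

/-- On a ball of radius `r ≤ 1` the map `x ↦ y + L x + B x x + T x x x` is Lipschitz
with constant `N + (2 * K₂ + 3 * K₃) * r`. -/
theorem norm_cubic_sub_le {X : Type*} [NormedAddCommGroup X] [NormedSpace ℝ X]
    {K₂ K₃ N r : ℝ} (hK₂ : 0 ≤ K₂) (hK₃ : 0 ≤ K₃)
    {B : X →L[ℝ] X →L[ℝ] X} (hB : ∀ x y : X, ‖B x y‖ ≤ K₂ * ‖x‖ * ‖y‖)
    {T : X →L[ℝ] X →L[ℝ] X →L[ℝ] X} (hT : ∀ x y z : X, ‖T x y z‖ ≤ K₃ * ‖x‖ * ‖y‖ * ‖z‖)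
    {L : X →L[ℝ] X} (hL : ∀ x : X, ‖L x‖ ≤ N * ‖x‖) (y : X) {x z : X}
    (hr : r ≤ 1) (hx : ‖x‖ ≤ r) (hz : ‖z‖ ≤ r) :
    ‖(y + L x + B x x + T x x x) - (y + L z + B z z + T z z z)‖ ≤
      (N + (2 * K₂ + 3 * K₃) * r) * ‖x - z‖ := by
  have hr0 : 0 ≤ r := (norm_nonneg x).trans hx
  have hsplit : (y + L x + B x x + T x x x) - (y + L z + B z z + T z z z) =
      L (x - z) + (B (x - z) x + B z (x - z)) +
        (T (x - z) x x + T z (x - z) x + T z z (x - z)) := by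
    simp only [map_sub, sub_apply]
    abel
  have hB₁ : ‖B (x - z) x‖ ≤ K₂ * ‖x - z‖ * r := (hB _ _).trans (by gcongr)
  have hB₂ : ‖B z (x - z)‖ ≤ K₂ * r * ‖x - z‖ := (hB _ _).trans (by gcongr)
  have hT₁ : ‖T (x - z) x x‖ ≤ K₃ * ‖x - z‖ * r * 1 :=
    (hT _ _ _).trans (by gcongr; exact hx.trans hr)
  have hT₂ : ‖T z (x - z) x‖ ≤ K₃ * r * ‖x - z‖ * 1 :=
    (hT _ _ _).trans (by gcongr; exact hx.trans hr)
  have hT₃ : ‖T z z (x - z)‖ ≤ K₃ * r * 1 * ‖x - z‖ :=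
    (hT _ _ _).trans (by gcongr; exact hz.trans hr)
  rw [hsplit]
  calc _ ≤ ‖L (x - z)‖ + (‖B (x - z) x‖ + ‖B z (x - z)‖) +
        (‖T (x - z) x x‖ + ‖T z (x - z) x‖ + ‖T z z (x - z)‖) :=
        norm_add_le_of_le (norm_add_le_of_le le_rfl (norm_add_le _ _)) norm_add₃_le
    _ ≤ _ := by linarith [hL (x - z)]

/-- The map `x ↦ y + L x + B x x + T x x x` is bounded by `‖y‖ + (1 + N) / 2 * ‖x‖` on the
ball of radius `min 1 ((1 - N) / (2 * K₂ + 3 * K₃))`. -/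
theorem norm_cubic_le {X : Type*} [NormedAddCommGroup X] [NormedSpace ℝ X]
    {K₂ K₃ N : ℝ} (hK₃ : 0 ≤ K₃)
    {B : X →L[ℝ] X →L[ℝ] X} (hB : ∀ x y : X, ‖B x y‖ ≤ K₂ * ‖x‖ * ‖y‖)
    {T : X →L[ℝ] X →L[ℝ] X →L[ℝ] X} (hT : ∀ x y z : X, ‖T x y z‖ ≤ K₃ * ‖x‖ * ‖y‖ * ‖z‖)
    {L : X →L[ℝ] X} (hL : ∀ x : X, ‖L x‖ ≤ N * ‖x‖) (y : X) {x : X}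
    (hx : ‖x‖ ≤ 1) (hxS : (2 * K₂ + 3 * K₃) * ‖x‖ ≤ 1 - N) :
    ‖y + L x + B x x + T x x x‖ ≤ ‖y‖ + (1 + N) / 2 * ‖x‖ := by
  have hT' : ‖T x x x‖ ≤ K₃ * ‖x‖ * ‖x‖ * 1 := (hT _ _ _).trans (by gcongr)
  have hS := mul_le_mul_of_nonneg_right hxS (norm_nonneg x)
  have hK : 0 ≤ K₃ * ‖x‖ * ‖x‖ := by positivity
  calc _ ≤ ‖y‖ + ‖L x‖ + ‖B x x‖ + ‖T x x x‖ := norm_add₄_le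
    _ ≤ _ := by linarith [hL x, hB x x]

/-- Fixed point lemma in a Banach space `X`: if `B` is a continuous bilinear map with norm
(bound) `K₂`, `T` a continuous trilinear map with norm (bound) `K₃`, and `L` a continuous
linear map of norm `N < 1`, then for every `y` with
`‖y‖ < min((1-N)/2, (1-N)²/(2(2K₂+3K₃)))`, the equation `x = y + L x + B(x,x) + T(x,x,x)`
has a unique solution in the closed ball of center `0` and radius
`R̃ = min(1, (1-N)/(2K₂+3K₃))`, and any such solution satisfies `‖x‖ ≤ 2/(1-N) ‖y‖`. -/
theorem stmt3 {X : Type*} [NormedAddCommGroup X] [NormedSpace ℝ X] [CompleteSpace X]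
    (K₂ K₃ N : ℝ) (hK₂ : 0 ≤ K₂) (hK₃ : 0 ≤ K₃) (hN0 : 0 ≤ N) (hN1 : N < 1)
    (B : X →L[ℝ] X →L[ℝ] X) (hB : ∀ x y : X, ‖B x y‖ ≤ K₂ * ‖x‖ * ‖y‖)
    (T : X →L[ℝ] X →L[ℝ] X →L[ℝ] X) (hT : ∀ x y z : X, ‖T x y z‖ ≤ K₃ * ‖x‖ * ‖y‖ * ‖z‖)
    (L : X →L[ℝ] X) (hL : ∀ x : X, ‖L x‖ ≤ N * ‖x‖)
    (y : X) (hy : ‖y‖ < min ((1 - N) / 2) ((1 - N) ^ 2 / (2 * (2 * K₂ + 3 * K₃)))) :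
    (∃! x : X, x ∈ closedBall (0 : X) (min 1 ((1 - N) / (2 * K₂ + 3 * K₃))) ∧
        x = y + L x + B x x + T x x x) ∧
      ∀ x : X, x ∈ closedBall (0 : X) (min 1 ((1 - N) / (2 * K₂ + 3 * K₃))) →
        x = y + L x + B x x + T x x x → ‖x‖ ≤ 2 / (1 - N) * ‖y‖ := by
  have hm : 0 < 1 - N := sub_pos.2 hN1
  obtain ⟨hy₁, hy₂⟩ := lt_min_iff.1 hy
  have hS : 0 < 2 * K₂ + 3 * K₃ := by
    rcases (show 0 ≤ 2 * K₂ + 3 * K₃ by positivity).eq_or_lt with h | h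
    · rw [← h] at hy₂
      simp only [mul_zero, div_zero] at hy₂
      exact absurd hy₂ (norm_nonneg y).not_gt
    · exact h
  set S := 2 * K₂ + 3 * K₃ with hS_def
  have mem_ball (x : X) : x ∈ closedBall (0 : X) (min 1 ((1 - N) / S)) ↔
      ‖x‖ ≤ 1 ∧ S * ‖x‖ ≤ 1 - N := by
    rw [mem_closedBall_zero_iff, le_min_iff, le_div_iff₀' hS]
  set r := 2 / (1 - N) * ‖y‖ with hr
  have hr0 : 0 ≤ r := by positivity
  have hmr : (1 - N) * r = 2 * ‖y‖ := by rw [hr]; field_simp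
  have hr1 : r ≤ 1 := by
    refine le_of_mul_le_mul_left ?_ hm
    linarith
  have hSr : S * r < 1 - N := by
    rw [lt_div_iff₀ (by positivity)] at hy₂
    refine lt_of_mul_lt_mul_left ?_ hm.le
    linear_combination hy₂ + S * hmr
  have bound (x : X) (hx : x ∈ closedBall (0 : X) (min 1 ((1 - N) / S)))
      (hfix : x = y + L x + B x x + T x x x) : ‖x‖ ≤ r := by
    obtain ⟨hx1, hxS⟩ := (mem_ball x).1 hx
    have h := norm_cubic_le hK₃ hB hT hL y hx1 hxS
    rw [← hfix] at h
    refine le_of_mul_le_mul_left ?_ hm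
    linarith
  have hlip {x z : X} (hx : ‖x‖ ≤ r) (hz : ‖z‖ ≤ r) :=
    norm_cubic_sub_le hK₂ hK₃ hB hT hL y hr1 hx hz
  have small {x : X} (hx : ‖x‖ ≤ r) : ‖x‖ ≤ 1 ∧ S * ‖x‖ ≤ 1 - N :=
    ⟨hx.trans hr1, (mul_le_mul_of_nonneg_left hx hS.le).trans hSr.le⟩
  have hmaps : Set.MapsTo (fun x ↦ y + L x + B x x + T x x x)
      (closedBall (0 : X) r) (closedBall (0 : X) r) := by
    intro x hx
    rw [mem_closedBall_zero_iff] at hx ⊢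
    have h := norm_cubic_le hK₃ hB hT hL y (small hx).1 (small hx).2
    have h' := mul_le_mul_of_nonneg_left hx (show 0 ≤ (1 + N) / 2 by positivity)
    linarith
  obtain ⟨k, hk⟩ : ∃ k : NNReal, (k : ℝ) = N + S * r :=
    ⟨Real.toNNReal (N + S * r), Real.coe_toNNReal _ (by positivity)⟩
  have hcontr : ContractingWith k (hmaps.restrict _ _ _) := by
    refine ⟨by rw [← NNReal.coe_lt_coe, hk, NNReal.coe_one]; linarith,
      LipschitzWith.of_dist_le_mul fun x z ↦ ?_⟩
    rw [Subtype.dist_eq, Subtype.dist_eq, dist_eq_norm, dist_eq_norm, hk]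
    exact hlip (mem_closedBall_zero_iff.1 x.2) (mem_closedBall_zero_iff.1 z.2)
  obtain ⟨x, hx, hfix, -⟩ := ContractingWith.exists_fixedPoint' isClosed_closedBall.isComplete hmaps
    hcontr (mem_closedBall_self hr0) (edist_ne_top _ _)
  rw [mem_closedBall_zero_iff] at hx
  refine ⟨⟨x, ⟨(mem_ball x).2 (small hx), hfix.symm⟩, ?_⟩, bound⟩
  rintro z ⟨hz, hzfix⟩
  have h := hlip (bound z hz hzfix) hx
  rw [← hzfix, show y + L x + B x x + T x x x = x from hfix] at h
  have hzero : ‖z - x‖ ≤ 0 := by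
    by_contra! hpos
    exact absurd h (not_le.2 (mul_lt_of_lt_one_left hpos (by linarith)))
  exact sub_eq_zero.1 (norm_le_zero_iff.1 hzero)
end

section
/- Let d ≥ 1, μ > 0, λ ∈ ℝ with ν := λ + 2μ > 0, and κ > 0 with ν² ≠ 4κ. Fix ξ ∈ ℝ^d with ξ ≠ 0, and let λ₊, λ₋ ∈ ℂ be the two (distinct) roots of λ² + ν|ξ|²λ + κ|ξ|⁴ = 0. Given a₀ ∈ ℂ and m₀ ∈ ℂ^d, define A : [0,∞) → ℂ and M : [0,∞) → ℂ^d by A(t) = [ (λ₊ e^{λ₋ t} − λ₋ e^{λ₊ t})/(λ₊ − λ₋) ] a₀ − i [ (e^{λ₊ t} − e^{λ₋ t})/(λ₊ − λ₋) ] (ξ·m₀) and M(t) = e^{−μ|ξ|² t} m₀ − i κ |ξ|² [ (e^{λ₊ t} − e^{λ₋ t})/(λ₊ − λ₋) ] a₀ ξ + ( [ (λ₊ e^{λ₊ t} − λ₋ e^{λ₋ t})/(λ₊ − λ₋) ] − e^{−μ|ξ|² t} ) (ξ·m₀) ξ / |ξ|². Then A(0) = a₀, M(0) = m₀, and for all t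 ≥ 0: A'(t) + i ξ·M(t) = 0 and M'(t) + μ|ξ|² M(t) + (λ+μ)(ξ·M(t)) ξ + i κ |ξ|² A(t) ξ = 0. -/
open MeasureTheory Real

lemma hasDerivAt_cexp_mul_ofReal (c : ℂ) (t : ℝ) :
    HasDerivAt (fun t : ℝ => Complex.exp (c * (t : ℂ))) (c * Complex.exp (c * (t : ℂ))) t := by
  have h : HasDerivAt (fun t : ℝ => c * (t : ℂ)) (c * 1) t :=
    (Complex.ofRealCLM.hasDerivAt (x := t)).const_mul c
  convert h.cexp using 1
  ring

lemma sum_ofReal_mul_self {d : ℕ} (ξ : EuclideanSpace ℝ (Fin d)) :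
    ∑ k, (ξ k : ℂ) * (ξ k : ℂ) = ((‖ξ‖ ^ 2 : ℝ) : ℂ) := by
  rw [EuclideanSpace.real_norm_sq_eq]
  push_cast
  exact Finset.sum_congr rfl fun k _ => (sq _).symm

/-- Green-matrix representation for the linearized compressible Navier–Stokes–Korteweg
system with zero sound speed, Fourier side, non-degenerate case `ν² ≠ 4κ` (`ν = λ + 2μ`):
for `ξ ≠ 0` and distinct roots `λ₊ ≠ λ₋` of `λ² + ν|ξ|²λ + κ|ξ|⁴ = 0`, the explicit
functions `A, M` below satisfy `A(0) = a₀`, `M(0) = m₀`, and for all `t ≥ 0`,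
`A' + iξ·M = 0` and `M' + μ|ξ|²M + (λ+μ)(ξ·M)ξ + iκ|ξ|²Aξ = 0`. -/
theorem stmt13 (d : ℕ) (hd : 1 ≤ d) (μ lamv κ : ℝ) (hμ : 0 < μ)
    (hν : 0 < lamv + 2 * μ) (hκ : 0 < κ) (hdisc : (lamv + 2 * μ) ^ 2 ≠ 4 * κ)
    (ξ : EuclideanSpace ℝ (Fin d)) (hξ : ξ ≠ 0)
    (lp lm : ℂ) (hne : lp ≠ lm)
    (hlp : lp ^ 2 + (((lamv + 2 * μ) * ‖ξ‖ ^ 2 : ℝ) : ℂ) * lp + ((κ * ‖ξ‖ ^ 4 : ℝ) : ℂ) = 0)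
    (hlm : lm ^ 2 + (((lamv + 2 * μ) * ‖ξ‖ ^ 2 : ℝ) : ℂ) * lm + ((κ * ‖ξ‖ ^ 4 : ℝ) : ℂ) = 0)
    (a₀ : ℂ) (m₀ : EuclideanSpace ℂ (Fin d)) :
    let ξc : EuclideanSpace ℂ (Fin d) := (WithLp.equiv 2 (Fin d → ℂ)).symm fun k => (ξ k : ℂ)
    let dot : EuclideanSpace ℂ (Fin d) → ℂ := fun v => ∑ k, (ξ k : ℂ) * v k
    let A : ℝ → ℂ := fun t =>
      ((lp * Complex.exp (lm * (t : ℂ)) - lm * Complex.exp (lp * (t : ℂ))) / (lp - lm)) * a₀ -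
        Complex.I * ((Complex.exp (lp * (t : ℂ)) - Complex.exp (lm * (t : ℂ))) / (lp - lm)) *
          dot m₀
    let M : ℝ → EuclideanSpace ℂ (Fin d) := fun t =>
      ((Real.exp (-(μ * ‖ξ‖ ^ 2 * t)) : ℝ) : ℂ) • m₀ -
        (Complex.I * (κ : ℂ) * ((‖ξ‖ ^ 2 : ℝ) : ℂ) *
          ((Complex.exp (lp * (t : ℂ)) - Complex.exp (lm * (t : ℂ))) / (lp - lm)) * a₀) • ξc +
        ((((lp * Complex.exp (lp * (t : ℂ)) - lm * Complex.exp (lm * (t : ℂ))) / (lp - lm)) -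
            ((Real.exp (-(μ * ‖ξ‖ ^ 2 * t)) : ℝ) : ℂ)) * dot m₀ / ((‖ξ‖ ^ 2 : ℝ) : ℂ)) • ξc
    A 0 = a₀ ∧ M 0 = m₀ ∧
      ∀ t : ℝ, 0 ≤ t →
        HasDerivAt A (-(Complex.I * dot (M t))) t ∧
        HasDerivAt M (-(((μ * ‖ξ‖ ^ 2 : ℝ) : ℂ) • M t +
            (((lamv + μ : ℝ) : ℂ) * dot (M t)) • ξc +
            (Complex.I * (κ : ℂ) * ((‖ξ‖ ^ 2 : ℝ) : ℂ) * A t) • ξc)) t := by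
  intro ξc dot A M
  have hs : ((‖ξ‖ ^ 2 : ℝ) : ℂ) ≠ 0 := by
    exact_mod_cast pow_ne_zero 2 (norm_ne_zero_iff.mpr hξ)
  have hd' : lp - lm ≠ 0 := sub_ne_zero.mpr hne
  have dot_add (u v) : dot (u + v) = dot u + dot v := by
    simp [dot, mul_add, Finset.sum_add_distrib]
  have dot_sub (u v) : dot (u - v) = dot u - dot v := by
    simp [dot, mul_sub, Finset.sum_sub_distrib]
  have dot_smul (c : ℂ) (v) : dot (c • v) = c * dot v := by
    simp [dot, Finset.mul_sum, mul_left_comm]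
  have dot_ξc : dot ξc = ((‖ξ‖ ^ 2 : ℝ) : ℂ) := sum_ofReal_mul_self ξ
  have hexp (t : ℝ) : ((Real.exp (-(μ * ‖ξ‖ ^ 2 * t)) : ℝ) : ℂ) =
      Complex.exp (-((μ : ℂ) * ((‖ξ‖ ^ 2 : ℝ) : ℂ)) * (t : ℂ)) := by
    push_cast
    ring_nf
  have h4 : ((κ * ‖ξ‖ ^ 4 : ℝ) : ℂ) = κ * ((‖ξ‖ ^ 2 : ℝ) : ℂ) ^ 2 := by
    push_cast
    ring
  have hνs : (((lamv + 2 * μ) * ‖ξ‖ ^ 2 : ℝ) : ℂ) =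
      ((lamv : ℂ) + 2 * μ) * ((‖ξ‖ ^ 2 : ℝ) : ℂ) := by
    push_cast
    ring
  have hμs : ((μ * ‖ξ‖ ^ 2 : ℝ) : ℂ) = (μ : ℂ) * ((‖ξ‖ ^ 2 : ℝ) : ℂ) := by
    push_cast
    ring
  rw [h4, hνs] at hlp hlm
  rw [hμs]
  simp only [A, M, hexp, dot_add, dot_sub, dot_smul, dot_ξc]
  generalize ((‖ξ‖ ^ 2 : ℝ) : ℂ) = s at *
  generalize dot m₀ = D
  have hsum : ((lamv : ℂ) + 2 * μ) * s = -(lp + lm) :=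
    mul_left_cancel₀ hd' (by linear_combination hlp - hlm)
  have hprod : (κ : ℂ) * s ^ 2 = lp * lm := by
    linear_combination hlp - lp * hsum
  refine ⟨?_, ?_, fun t _ => ?_⟩
  · simp [hd']
  · simp [hd']
  have hp := hasDerivAt_cexp_mul_ofReal lp t
  have hm := hasDerivAt_cexp_mul_ofReal lm t
  have he := hasDerivAt_cexp_mul_ofReal (-((μ : ℂ) * s)) t
  have hr : s * s⁻¹ = 1 := mul_inv_cancel₀ hs
  simp only [div_eq_mul_inv]
  constructor
  · refine HasDerivAt.congr_deriv (((((hm.const_mul lp).sub (hp.const_mul lm)).mul_const (lp - lm)⁻¹).mul_const a₀).sub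
      ((((hp.sub hm).mul_const (lp - lm)⁻¹).const_mul Complex.I).mul_const D)) ?_
    generalize (lp - lm)⁻¹ = w
    generalize s⁻¹ = r at *
    generalize Complex.exp (lp * t) = P
    generalize Complex.exp (lm * t) = Q
    generalize Complex.exp (-((μ : ℂ) * s) * t) = R
    linear_combination w * a₀ * (P - Q) * hprod - w * a₀ * (P - Q) * κ * s ^ 2 * Complex.I_sq +
      Complex.I * (w * (lp * P - lm * Q) - R) * D * hr
  · refine HasDerivAt.congr_deriv (((he.smul_const m₀).sub
      (((((hp.sub hm).mul_const (lp - lm)⁻¹).const_mul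
        (Complex.I * (κ : ℂ) * s)).mul_const a₀).smul_const ξc)).add
      (((((((hp.const_mul lp).sub (hm.const_mul lm)).mul_const (lp - lm)⁻¹).sub he).mul_const
        D).mul_const s⁻¹).smul_const ξc)) ?_
    generalize (lp - lm)⁻¹ = w
    generalize s⁻¹ = r at *
    generalize Complex.exp (lp * t) = P
    generalize Complex.exp (lm * t) = Q
    generalize Complex.exp (-((μ : ℂ) * s) * t) = R
    clear_value ξc
    push_cast
    match_scalars
    · ring
    · linear_combination (D * r * w * (lp * P - lm * Q) -
          Complex.I * κ * s * a₀ * w * (P - Q)) * hsum + D * r * w * (P - Q) * hprod -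
        D * ((lamv + μ) * R + κ * s * w * (P - Q)) * hr -
        D * κ * s * w * (P - Q) * Complex.I_sq
end

section
/- Let d ≥ 1, ν > 0, 1 ≤ q ≤ ∞, j ∈ ℤ, T ∈ (0, ∞], and 1 ≤ r₁ ≤ r ≤ ∞. There exists a constant C > 0, depending only on r and r₁ (not on j, ν, T), with the following property: let u₀ ∈ L^q(ℝ^d) vanish outside the annulus A_j := {ξ : 2^{j−1} ≤ |ξ| ≤ 2^{j+1}}, let f : (0,T) × ℝ^d → ℂ be measurable with f(t,·) ∈ L^q vanishing outside A_j for a.e. t, and define u(t,ξ) := e^{−ν t |ξ|²} u₀(ξ) + ∫₀ᵗ e^{−ν(t−τ)|ξ|²} f(τ,ξ) dτ. Then ν^{1/r} 2^{2j/r} ‖ ‖u(t,·)‖_{L^q(ℝ^d)} ‖_{L^r(0,T)} ≤ C ( ‖u₀‖_{L^q(ℝ^d)} + ν^{−1+1/r₁} 2^{2j(−1+1/r₁)} ‖ ‖f(t,·)‖_{L^q(ℝ^d)} ‖_{L^{r₁}(0,T)} ). -/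
open MeasureTheory ENNReal

/-- The `L^r` norm in time on a set `S ⊆ ℝ` of an `ℝ≥0∞`-valued quantity, for an
exponent `r ∈ [1,∞]` given as an element of `ℝ≥0∞`. -/
noncomputable def timeLp (r : ℝ≥0∞) (S : Set ℝ) (g : ℝ → ℝ≥0∞) : ℝ≥0∞ :=
  if r = ∞ then essSup g (MeasureTheory.volume.restrict S)
  else (∫⁻ t in S, g t ^ r.toReal) ^ (1 / r.toReal)

/-- Jensen's inequality with a weight `a`, as a consequence of Hölder's inequality. -/
theorem lintegral_mul_rpow_le {α : Type*} [MeasurableSpace α] {μ : Measure α}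
    {a b : α → ℝ≥0∞} (ha : Measurable a) (hb : Measurable b) {p : ℝ} (hp : 1 ≤ p) :
    (∫⁻ x, a x * b x ∂μ) ^ p ≤ (∫⁻ x, a x ∂μ) ^ (p - 1) * ∫⁻ x, a x * b x ^ p ∂μ := by
  rcases hp.eq_or_lt with rfl | hp1
  · simp
  have hp0 : 0 < p := by linarith
  have hpq : p.HolderConjugate (p / (p - 1)) := Real.HolderConjugate.conjExponent hp1
  have hq0 : 0 < p / (p - 1) := hpq.symm.pos
  have key := ENNReal.lintegral_mul_le_Lp_mul_Lq μ hpq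
    (f := fun x => a x ^ (1 / p) * b x) (g := fun x => a x ^ (1 / (p / (p - 1))))
    ((ha.pow_const _).mul hb).aemeasurable (ha.pow_const _).aemeasurable
  have e1 : ∀ x, a x ^ (1 / p) * b x * a x ^ (1 / (p / (p - 1))) = a x * b x := fun x => by
    rw [mul_right_comm, ← ENNReal.rpow_add_of_nonneg _ _ (by positivity) (by positivity)]
    have : 1 / p + 1 / (p / (p - 1)) = 1 := by
      have : p - 1 ≠ 0 := by linarith
      field_simp; ring
    rw [this, ENNReal.rpow_one]
  have e2 : ∀ x, (a x ^ (1 / p) * b x) ^ p = a x * b x ^ p := fun x => by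
    rw [ENNReal.mul_rpow_of_nonneg _ _ hp0.le, ← ENNReal.rpow_mul, one_div_mul_cancel hp0.ne',
      ENNReal.rpow_one]
  have e3 : ∀ x, (a x ^ (1 / (p / (p - 1)))) ^ (p / (p - 1)) = a x := fun x => by
    rw [← ENNReal.rpow_mul, one_div_mul_cancel hq0.ne', ENNReal.rpow_one]
  simp only [Pi.mul_apply, e1, e2, e3] at key
  refine (ENNReal.rpow_le_rpow key hp0.le).trans ?_
  rw [ENNReal.mul_rpow_of_nonneg _ _ hp0.le, ← ENNReal.rpow_mul, ← ENNReal.rpow_mul,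
    one_div_mul_cancel hp0.ne', ENNReal.rpow_one, mul_comm]
  have : 1 / (p / (p - 1)) * p = p - 1 := by field_simp
  rw [this]

theorem measurable_eLpNorm_curry {α β : Type*} [MeasurableSpace α] [MeasurableSpace β]
    {ρ : Measure β} [SFinite ρ] {F : α → β → ℝ≥0∞} (hF : Measurable (Function.uncurry F))
    {q : ℝ≥0∞} (hq : q ≠ 0) : Measurable (fun x => eLpNorm (F x) q ρ) := by
  by_cases hqt : q = ∞
  · subst hqt
    simp only [eLpNorm_exponent_top, eLpNormEssSup, enorm_eq_self]
    refine measurable_of_Iic fun c => ?_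
    have : (fun x => essSup (F x) ρ) ⁻¹' Set.Iic c
        = (fun x => ρ (Prod.mk x ⁻¹' (Function.uncurry F ⁻¹' Set.Ioi c))) ⁻¹' {0} := by
      ext x
      simp only [Set.mem_preimage, Set.mem_Iic, Set.mem_singleton_iff]
      constructor
      · intro h
        have h2 : ∀ᵐ y ∂ρ, F x y ≤ c := (ENNReal.ae_le_essSup (F x)).mono fun y hy => hy.trans h
        rw [ae_iff] at h2
        convert h2 using 2
        ext y; simp [Function.uncurry]
      · intro h
        refine essSup_le_of_ae_le c ?_
        change ∀ᵐ y ∂ρ, F x y ≤ c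
        rw [ae_iff]
        convert h using 2
        ext y; simp [Function.uncurry]
    rw [this]
    exact measurable_measure_prodMk_left (hF measurableSet_Ioi) (measurableSet_singleton 0)
  · simp only [eLpNorm_eq_lintegral_rpow_enorm_toReal hq hqt, enorm_eq_self]
    exact (Measurable.lintegral_prod_right' (f := fun z : α × β => Function.uncurry F z ^ q.toReal)
      (hF.pow_const _)).pow_const _

/-- Minkowski's integral inequality. -/
theorem eLpNorm_lintegral_le {α β : Type*} [MeasurableSpace α] [MeasurableSpace β]
    {μ : Measure α} {ρ : Measure β} [SFinite μ] [SFinite ρ] {F : α → β → ℝ≥0∞}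
    (hF : Measurable (Function.uncurry F)) {q : ℝ≥0∞} (hq : 1 ≤ q) :
    eLpNorm (fun y => ∫⁻ x, F x y ∂μ) q ρ ≤ ∫⁻ x, eLpNorm (F x) q ρ ∂μ := by
  have hq0 : q ≠ 0 := (zero_lt_one.trans_le hq).ne'
  have hN := measurable_eLpNorm_curry (ρ := ρ) hF hq0
  have hFx : ∀ x, Measurable (F x) := fun x => hF.comp measurable_prodMk_left
  have hFy : ∀ y, Measurable (fun x => F x y) := fun y => hF.comp measurable_prodMk_right
  by_cases hqt : q = ∞
  · subst hqt
    rw [eLpNorm_exponent_top]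
    refine eLpNormEssSup_le_of_ae_enorm_bound ?_
    have h1 : ∀ᵐ x ∂μ, ∀ᵐ y ∂ρ, F x y ≤ eLpNorm (F x) ∞ ρ := by
      refine Filter.Eventually.of_forall fun x => ?_
      simpa [eLpNorm_exponent_top] using enorm_ae_le_eLpNormEssSup (F x) ρ
    have h2 : ∀ᵐ y ∂ρ, ∀ᵐ x ∂μ, F x y ≤ eLpNorm (F x) ∞ ρ := by
      rwa [Measure.ae_ae_comm] at h1
      exact measurableSet_le hF (hN.comp measurable_fst)
    filter_upwards [h2] with y hy
    rw [enorm_eq_self]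
    exact lintegral_mono_ae hy
  · set p := q.toReal
    have hp : 1 ≤ p := by
      rw [← ENNReal.toReal_one]; exact (ENNReal.toReal_le_toReal one_ne_top hqt).2 hq
    have hp0 : 0 < p := by linarith
    set N : α → ℝ≥0∞ := fun x => eLpNorm (F x) q ρ with hNdef
    by_cases htop : ∫⁻ x, N x ∂μ = ∞
    · rw [htop]; exact le_top
    have hNp : ∀ x, ∫⁻ y, F x y ^ p ∂ρ = N x ^ p := fun x => by
      simp only [hNdef, eLpNorm_eq_lintegral_rpow_enorm_toReal hq0 hqt, enorm_eq_self]
      rw [← ENNReal.rpow_mul, one_div_mul_cancel hp0.ne', ENNReal.rpow_one]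
    have h1 : ∀ᵐ x ∂μ, ∀ᵐ y ∂ρ, F x y = N x * (F x y / N x) := by
      filter_upwards [ae_lt_top hN htop] with x hx
      by_cases h0 : N x = 0
      · have := (eLpNorm_eq_zero_iff (hFx x).aestronglyMeasurable hq0).1 h0
        filter_upwards [this] with y hy
        simp [hy]
      · exact Filter.Eventually.of_forall fun y => (ENNReal.mul_div_cancel h0 hx.ne).symm
    have hNm : Measurable fun z : α × β => N z.1 := hN.comp measurable_fst
    have hdiv : Measurable fun z : α × β => F z.1 z.2 / N z.1 := Measurable.div hF hNm
    have h2 : ∀ᵐ y ∂ρ, ∀ᵐ x ∂μ, F x y = N x * (F x y / N x) := by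
      rwa [Measure.ae_ae_comm] at h1
      exact measurableSet_eq_fun hF (hNm.mul hdiv)
    have h3 : ∫⁻ y, (∫⁻ x, F x y ∂μ) ^ p ∂ρ ≤ (∫⁻ x, N x ∂μ) ^ p := by
      calc ∫⁻ y, (∫⁻ x, F x y ∂μ) ^ p ∂ρ
          ≤ ∫⁻ y, (∫⁻ x, N x ∂μ) ^ (p - 1) * ∫⁻ x, N x * (F x y / N x) ^ p ∂μ ∂ρ := by
            refine lintegral_mono_ae ?_
            filter_upwards [h2] with y hy
            rw [lintegral_congr_ae hy]
            exact lintegral_mul_rpow_le hN ((hFy y).div hN) hp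
        _ = (∫⁻ x, N x ∂μ) ^ (p - 1) * ∫⁻ x, ∫⁻ y, N x * (F x y / N x) ^ p ∂ρ ∂μ := by
            rw [lintegral_const_mul, lintegral_lintegral_swap]
            · exact ((hNm.mul (hdiv.pow_const p)).comp measurable_swap).aemeasurable
            · exact Measurable.lintegral_prod_left' (f := fun z : α × β =>
                N z.1 * (F z.1 z.2 / N z.1) ^ p) (hNm.mul (hdiv.pow_const p))
        _ ≤ (∫⁻ x, N x ∂μ) ^ (p - 1) * ∫⁻ x, N x ∂μ := by
            gcongr with x
            rw [lintegral_const_mul _ (((hFx x).div_const _).pow_const _)]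
            simp only [ENNReal.div_rpow_of_nonneg _ _ hp0.le]
            simp only [div_eq_mul_inv]
            rw [lintegral_mul_const _ ((hFx x).pow_const _), hNp, ← div_eq_mul_inv]
            exact mul_le_of_le_one_right' ENNReal.div_self_le_one
        _ = (∫⁻ x, N x ∂μ) ^ p := by
            nth_rewrite 2 [← ENNReal.rpow_one (∫⁻ x, N x ∂μ)]
            rw [← ENNReal.rpow_add_of_nonneg _ _ (by linarith) zero_le_one, sub_add_cancel]
    rw [eLpNorm_eq_lintegral_rpow_enorm_toReal hq0 hqt]
    simp only [enorm_eq_self]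
    calc _ ≤ ((∫⁻ x, N x ∂μ) ^ p) ^ (1 / p) := ENNReal.rpow_le_rpow h3 (by positivity)
      _ = _ := by rw [← ENNReal.rpow_mul, mul_one_div_cancel hp0.ne', ENNReal.rpow_one]

/-- Young's convolution inequality for a kernel bounded by `1`. -/
theorem eLpNorm_lconvolution_le {k g : ℝ → ℝ≥0∞} (hk : Measurable k) (hg : Measurable g)
    (hk1 : ∀ s, k s ≤ 1) {r r₁ : ℝ≥0∞} (hr₁ : 1 ≤ r₁) (hrr : r₁ ≤ r) :
    eLpNorm (fun t => ∫⁻ τ, k (t - τ) * g τ) r volume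
      ≤ (∫⁻ s, k s) ^ (1 - (1 / r₁).toReal + (1 / r).toReal) * eLpNorm g r₁ volume := by
  set K := ∫⁻ s, k s
  have hr₁0 : r₁ ≠ 0 := (zero_lt_one.trans_le hr₁).ne'
  have hr0 : r ≠ 0 := (zero_lt_one.trans_le (hr₁.trans hrr)).ne'
  have hkt : ∀ t, Measurable fun τ => k (t - τ) := fun t =>
    hk.comp (measurable_const.sub measurable_id)
  have hkK : ∀ t, ∫⁻ τ, k (t - τ) = K := fun t => lintegral_sub_left_eq_self k t
  by_cases h1t : r₁ = ∞
  · subst h1t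
    obtain rfl : r = ∞ := top_le_iff.1 hrr
    rw [eLpNorm_exponent_top]
    refine eLpNormEssSup_le_of_ae_enorm_bound (Filter.Eventually.of_forall fun t => ?_)
    have hb : ∀ᵐ τ, g τ ≤ eLpNorm g ∞ volume := by
      simpa [eLpNorm_exponent_top] using enorm_ae_le_eLpNormEssSup g volume
    calc _ ≤ ∫⁻ τ, k (t - τ) * eLpNorm g ∞ volume := by
          rw [enorm_eq_self]
          refine lintegral_mono_ae (hb.mono fun τ hτ => ?_)
          gcongr
      _ = _ := by rw [lintegral_mul_const _ (hkt t), hkK]; simp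
  set p := r₁.toReal
  have hp : 1 ≤ p := by
    rw [← ENNReal.toReal_one]; exact (ENNReal.toReal_le_toReal one_ne_top h1t).2 hr₁
  have hp0 : 0 < p := by linarith
  set G := ∫⁻ τ, g τ ^ p
  set w : ℝ → ℝ≥0∞ := fun t => ∫⁻ τ, k (t - τ) * g τ ^ p
  have hw : ∀ t, (∫⁻ τ, k (t - τ) * g τ) ^ p ≤ K ^ (p - 1) * w t := fun t => by
    rw [← hkK t]; exact lintegral_mul_rpow_le (hkt t) hg hp
  have hwG : ∀ t, w t ≤ G := fun t => lintegral_mono fun τ => mul_le_of_le_one_left' (hk1 _)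
  have hm : Measurable fun z : ℝ × ℝ => k (z.1 - z.2) * g z.2 ^ p :=
    (hk.comp (measurable_fst.sub measurable_snd)).mul ((hg.comp measurable_snd).pow_const _)
  have hwm : Measurable w := hm.lintegral_prod_right'
  have hwint : ∫⁻ t, w t = K * G := by
    simp only [w]
    rw [lintegral_lintegral_swap hm.aemeasurable, ← lintegral_const_mul _ (hg.pow_const _)]
    refine lintegral_congr fun τ => ?_
    have hkτ : Measurable fun t => k (t - τ) := hk.comp (measurable_id.sub measurable_const)
    rw [lintegral_mul_const _ hkτ]
    congr 1
    exact lintegral_sub_right_eq_self k τ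
  have hgG : eLpNorm g r₁ volume = G ^ (1 / p) := by
    rw [eLpNorm_eq_lintegral_rpow_enorm_toReal hr₁0 h1t]; simp [G, p]
  have hinv : (1 / r₁).toReal = 1 / p := by simp [p]
  have hp1 : 1 / p ≤ 1 := by rw [div_le_one hp0]; exact hp
  rw [hgG, hinv]
  by_cases hrt : r = ∞
  · subst hrt
    rw [eLpNorm_exponent_top]
    refine eLpNormEssSup_le_of_ae_enorm_bound (Filter.Eventually.of_forall fun t => ?_)
    rw [enorm_eq_self]
    calc _ = ((∫⁻ τ, k (t - τ) * g τ) ^ p) ^ (1 / p) := by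
          rw [← ENNReal.rpow_mul, mul_one_div_cancel hp0.ne', ENNReal.rpow_one]
      _ ≤ (K ^ (p - 1) * G) ^ (1 / p) :=
          ENNReal.rpow_le_rpow ((hw t).trans (by gcongr; exact hwG t)) (by positivity)
      _ = _ := by
          rw [ENNReal.mul_rpow_of_nonneg _ _ (by positivity), ← ENNReal.rpow_mul]
          congr 2
          simp; field_simp
  set s := r.toReal
  have hps : p ≤ s := (ENNReal.toReal_le_toReal h1t hrt).2 hrr
  have hs0 : 0 < s := by linarith
  have hsp : 1 ≤ s / p := by rw [one_le_div hp0]; exact hps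
  have hinv' : (1 / r).toReal = 1 / s := by simp [s]
  have hws : ∫⁻ t, w t ^ (s / p) ≤ K * G ^ (s / p) := by
    have split : ∀ x : ℝ≥0∞, x ^ (s / p) = x ^ (s / p - 1) * x := fun x => by
      nth_rewrite 3 [← ENNReal.rpow_one x]
      rw [← ENNReal.rpow_add_of_nonneg _ _ (by linarith) zero_le_one, sub_add_cancel]
    calc _ ≤ ∫⁻ t, G ^ (s / p - 1) * w t := by
          refine lintegral_mono fun t => ?_
          rw [split]
          gcongr
          exact hwG t
      _ = _ := by rw [lintegral_const_mul _ hwm, hwint, split G]; ring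
  rw [eLpNorm_eq_lintegral_rpow_enorm_toReal hr0 hrt, hinv']
  simp only [enorm_eq_self]
  calc _ ≤ (∫⁻ t, (K ^ (p - 1) * w t) ^ (s / p)) ^ (1 / s) := by
        gcongr with t
        calc _ = ((∫⁻ τ, k (t - τ) * g τ) ^ p) ^ (s / p) := by
              rw [← ENNReal.rpow_mul, mul_div_cancel₀ _ hp0.ne']
          _ ≤ _ := ENNReal.rpow_le_rpow (hw t) (by positivity)
    _ ≤ (K ^ ((p - 1) * (s / p)) * (K * G ^ (s / p))) ^ (1 / s) := by
        gcongr
        simp only [ENNReal.mul_rpow_of_nonneg _ _ (zero_le_one.trans hsp), ← ENNReal.rpow_mul]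
        rw [lintegral_const_mul _ (hwm.pow_const _)]
        gcongr
    _ = _ := by
        have hs1 : 0 ≤ 1 / s := by positivity
        rw [ENNReal.mul_rpow_of_nonneg _ _ hs1, ENNReal.mul_rpow_of_nonneg _ _ hs1,
          ← ENNReal.rpow_mul, ← ENNReal.rpow_mul, ← mul_assoc,
          ← ENNReal.rpow_add_of_nonneg _ _
            (mul_nonneg (mul_nonneg (by linarith) (by linarith)) hs1) hs1]
        congr 2 <;> field_simp

theorem eLpNorm_mul_const_le {k : ℝ → ℝ≥0∞} (hk : Measurable k) (hk1 : ∀ s, k s ≤ 1)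
    {r : ℝ≥0∞} (hr : 1 ≤ r) (U : ℝ≥0∞) :
    eLpNorm (fun t => k t * U) r volume ≤ (∫⁻ s, k s) ^ (1 / r).toReal * U := by
  have hr0 : r ≠ 0 := (zero_lt_one.trans_le hr).ne'
  by_cases hrt : r = ∞
  · subst hrt
    rw [eLpNorm_exponent_top]
    refine eLpNormEssSup_le_of_ae_enorm_bound (Filter.Eventually.of_forall fun t => ?_)
    simpa using mul_le_of_le_one_left' (hk1 t)
  have hp : 1 ≤ r.toReal := by
    rw [← ENNReal.toReal_one]; exact (ENNReal.toReal_le_toReal one_ne_top hrt).2 hr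
  have hp0 : 0 < r.toReal := by linarith
  have hinv : (1 / r).toReal = 1 / r.toReal := by simp
  rw [eLpNorm_eq_lintegral_rpow_enorm_toReal hr0 hrt, hinv]
  simp only [enorm_eq_self, ENNReal.mul_rpow_of_nonneg _ _ hp0.le]
  rw [lintegral_mul_const _ (hk.pow_const _), ENNReal.mul_rpow_of_nonneg _ _ (by positivity),
    ← ENNReal.rpow_mul, mul_one_div_cancel hp0.ne', ENNReal.rpow_one]
  gcongr with s
  exact ENNReal.rpow_le_self_of_le_one (hk1 s) hp

theorem timeLp_eq_eLpNorm {r : ℝ≥0∞} (hr : r ≠ 0) (S : Set ℝ) (g : ℝ → ℝ≥0∞) :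
    timeLp r S g = eLpNorm g r (volume.restrict S) := by
  unfold timeLp
  split_ifs with h
  · subst h; simp [eLpNorm_exponent_top, eLpNormEssSup]
  · simp [eLpNorm_eq_lintegral_rpow_enorm_toReal hr h]

/-- The one-sided exponential kernel `s ↦ e^{-as} 1_{s ≥ 0}`. -/
noncomputable def expKernel (a : ℝ) : ℝ → ℝ≥0∞ :=
  (Set.Ici 0).indicator fun s => ENNReal.ofReal (Real.exp (-(a * s)))

theorem measurable_expKernel (a : ℝ) : Measurable (expKernel a) :=
  Measurable.indicator (by fun_prop) measurableSet_Ici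

theorem expKernel_le_one {a : ℝ} (ha : 0 < a) (s : ℝ) : expKernel a s ≤ 1 := by
  refine Set.indicator_apply_le' (fun hs => ?_) fun _ => zero_le_one
  rw [ENNReal.ofReal_le_one, Real.exp_le_one_iff]
  have : 0 ≤ a * s := mul_nonneg ha.le hs
  linarith

theorem lintegral_expKernel {a : ℝ} (ha : 0 < a) : ∫⁻ s, expKernel a s = ENNReal.ofReal a⁻¹ := by
  rw [expKernel, lintegral_indicator measurableSet_Ici, setLIntegral_congr Ioi_ae_eq_Ici.symm]
  have h := integral_exp_mul_Ioi (neg_lt_zero.2 ha) 0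
  have hi := integrableOn_exp_mul_Ioi (neg_lt_zero.2 ha) 0
  simp only [neg_mul] at h hi
  rw [← ofReal_integral_eq_lintegral_ofReal hi
    (Filter.Eventually.of_forall fun s => (Real.exp_pos _).le), h]
  simp

theorem eLpNorm_add_le_of_measurable {α : Type*} [MeasurableSpace α] {μ : Measure α}
    {g h : α → ℝ≥0∞} (hg : Measurable g) (hh : Measurable h) {q : ℝ≥0∞} (hq : 1 ≤ q) :
    eLpNorm (fun x => g x + h x) q μ ≤ eLpNorm g q μ + eLpNorm h q μ :=
  eLpNorm_add_le hg.aestronglyMeasurable hh.aestronglyMeasurable hq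

theorem eLpNorm_exp_mul_le {E : Type*} [NormedAddCommGroup E] [MeasurableSpace E]
    {ρ : Measure E} {A : Set E} {ν a s : ℝ} (hs : 0 ≤ s) (hA : ∀ ξ ∈ A, a ≤ ν * ‖ξ‖ ^ 2)
    {v : E → ℂ} (hv : ∀ ξ ∉ A, v ξ = 0) (q : ℝ≥0∞) :
    eLpNorm (fun ξ => ((Real.exp (-(ν * s * ‖ξ‖ ^ 2)) : ℝ) : ℂ) * v ξ) q ρ
      ≤ ENNReal.ofReal (Real.exp (-(a * s))) * eLpNorm v q ρ := by
  have h : eLpNorm (Real.exp (-(a * s)) • v) q ρ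
      = ENNReal.ofReal (Real.exp (-(a * s))) * eLpNorm v q ρ := by
    rw [eLpNorm_const_smul, Real.enorm_eq_ofReal (Real.exp_pos _).le]
  rw [← h]
  refine eLpNorm_mono fun ξ => ?_
  by_cases hξ : ξ ∈ A
  · rw [Pi.smul_apply, norm_smul, norm_mul, Complex.norm_real]
    simp only [Real.norm_eq_abs, Real.abs_exp]
    refine mul_le_mul_of_nonneg_right (Real.exp_le_exp.2 ?_) (norm_nonneg _)
    nlinarith [mul_le_mul_of_nonneg_right (hA ξ hξ) hs]
  · simp [hv ξ hξ]

theorem eLpNorm_duhamel_le {E : Type*} [NormedAddCommGroup E] [MeasurableSpace E] [BorelSpace E]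
    {ρ : Measure E} [SFinite ρ] {A : Set E} {ν a t : ℝ} (ht : 0 < t)
    (hA : ∀ ξ ∈ A, a ≤ ν * ‖ξ‖ ^ 2) {u₀ : E → ℂ} (hu₀ : Measurable u₀)
    (hu₀A : ∀ ξ ∉ A, u₀ ξ = 0) {f : ℝ → E → ℂ} (hf : Measurable (Function.uncurry f))
    (hfA : ∀ᵐ τ ∂(volume.restrict (Set.Ioc 0 t)), ∀ ξ ∉ A, f τ ξ = 0)
    {q : ℝ≥0∞} (hq : 1 ≤ q) :
    eLpNorm (fun ξ => ((Real.exp (-(ν * t * ‖ξ‖ ^ 2)) : ℝ) : ℂ) * u₀ ξ +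
        ∫ τ in (0 : ℝ)..t, ((Real.exp (-(ν * (t - τ) * ‖ξ‖ ^ 2)) : ℝ) : ℂ) * f τ ξ) q ρ
      ≤ ENNReal.ofReal (Real.exp (-(a * t))) * eLpNorm u₀ q ρ +
        ∫⁻ τ in Set.Ioc 0 t, ENNReal.ofReal (Real.exp (-(a * (t - τ)))) * eLpNorm (f τ) q ρ := by
  set F : ℝ → E → ℂ := fun τ ξ => ((Real.exp (-(ν * (t - τ) * ‖ξ‖ ^ 2)) : ℝ) : ℂ) * f τ ξ
  set v : E → ℂ := fun ξ => ((Real.exp (-(ν * t * ‖ξ‖ ^ 2)) : ℝ) : ℂ) * u₀ ξ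
  have hF : Measurable (Function.uncurry F) := by
    have he : Measurable fun z : ℝ × E => Real.exp (-(ν * (t - z.1) * ‖z.2‖ ^ 2)) := by
      fun_prop
    exact (Complex.measurable_ofReal.comp he).mul hf
  have hv : Measurable v := by
    have he : Measurable fun ξ : E => Real.exp (-(ν * t * ‖ξ‖ ^ 2)) := by fun_prop
    exact (Complex.measurable_ofReal.comp he).mul hu₀
  have hFe : Measurable (Function.uncurry fun τ ξ => ‖F τ ξ‖ₑ) := hF.enorm
  set I : E → ℝ≥0∞ := fun ξ => ∫⁻ τ in Set.Ioc 0 t, ‖F τ ξ‖ₑ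
  have hI : Measurable I :=
    Measurable.lintegral_prod_left' (f := fun z : ℝ × E => ‖F z.1 z.2‖ₑ) hFe
  have hve : Measurable fun ξ => ‖v ξ‖ₑ := hv.enorm
  have h1 : ∀ ξ, ‖v ξ + ∫ τ in (0 : ℝ)..t, F τ ξ‖ₑ ≤ ‖‖v ξ‖ₑ + I ξ‖ₑ := fun ξ => by
    rw [enorm_eq_self, intervalIntegral.integral_of_le ht.le]
    exact (enorm_add_le _ _).trans (add_le_add le_rfl (enorm_integral_le_lintegral_enorm _))
  have h2 : eLpNorm (fun ξ => ‖v ξ‖ₑ + I ξ) q ρ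
      ≤ eLpNorm (fun ξ => ‖v ξ‖ₑ) q ρ + eLpNorm I q ρ :=
    eLpNorm_add_le_of_measurable hve hI hq
  have h3 : eLpNorm (fun ξ => ‖v ξ‖ₑ) q ρ
      ≤ ENNReal.ofReal (Real.exp (-(a * t))) * eLpNorm u₀ q ρ := by
    rw [eLpNorm_enorm]
    exact eLpNorm_exp_mul_le ht.le hA hu₀A q
  have h4 : eLpNorm I q ρ ≤ ∫⁻ τ in Set.Ioc 0 t,
      ENNReal.ofReal (Real.exp (-(a * (t - τ)))) * eLpNorm (f τ) q ρ := by
    refine (eLpNorm_lintegral_le hFe hq).trans (lintegral_mono_ae ?_)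
    filter_upwards [hfA, ae_restrict_mem measurableSet_Ioc] with τ hτ hτt
    rw [eLpNorm_enorm]
    exact eLpNorm_exp_mul_le (sub_nonneg.2 hτt.2) hA hτ q
  exact (eLpNorm_mono_enorm h1).trans (h2.trans (add_le_add h3 h4))

theorem ofReal_mul_rpow_div_le {κ x y : ℝ} (hκ : 0 < κ) (hy0 : 0 ≤ y) (hy : y ≤ 2) :
    ENNReal.ofReal (κ ^ x) * ENNReal.ofReal (κ / 4)⁻¹ ^ y
      ≤ ENNReal.ofReal 16 * ENNReal.ofReal (κ ^ (x - y)) := by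
  rw [ENNReal.ofReal_rpow_of_nonneg (by positivity) hy0, ← ENNReal.ofReal_mul (by positivity),
    ← ENNReal.ofReal_mul (by norm_num)]
  refine ENNReal.ofReal_le_ofReal ?_
  have h4 : (4 : ℝ) ^ y ≤ 16 := by
    calc (4 : ℝ) ^ y ≤ 4 ^ (2 : ℝ) := Real.rpow_le_rpow_of_exponent_le (by norm_num) hy
      _ = 16 := by norm_num
  rw [inv_div, Real.div_rpow (by norm_num) hκ.le, Real.rpow_sub hκ]
  calc _ = 4 ^ y * (κ ^ x / κ ^ y) := by ring
    _ ≤ _ := by gcongr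


/-- Frequency-localized smoothing estimate for the inhomogeneous heat equation: for
`1 ≤ r₁ ≤ r ≤ ∞` there is `C > 0` depending only on `r, r₁` such that for any `d ≥ 1`,
`1 ≤ q ≤ ∞`, `ν > 0`, `j ∈ ℤ`, `T ∈ (0,∞]`, any `u₀` and `f(t,·)` supported (a.e. in `t`)
in the annulus `{2^{j-1} ≤ |ξ| ≤ 2^{j+1}}`, the Duhamel solution
`u(t,ξ) = e^{-νt|ξ|²}u₀(ξ) + ∫₀ᵗ e^{-ν(t-τ)|ξ|²} f(τ,ξ) dτ` satisfies
`ν^{1/r} 2^{2j/r} ‖‖u(t)‖_{L^q}‖_{L^r(0,T)}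
  ≤ C (‖u₀‖_{L^q} + ν^{-1+1/r₁} 2^{2j(-1+1/r₁)} ‖‖f(t)‖_{L^q}‖_{L^{r₁}(0,T)})`. -/
theorem stmt14 (r r₁ : ℝ≥0∞) (hr₁ : 1 ≤ r₁) (hrr : r₁ ≤ r) :
    ∃ C > 0, ∀ d : ℕ, 1 ≤ d → ∀ q : ℝ≥0∞, 1 ≤ q → ∀ ν : ℝ, 0 < ν →
      ∀ (j : ℤ) (T : ℝ≥0∞), 0 < T →
      ∀ u₀ : EuclideanSpace ℝ (Fin d) → ℂ, Measurable u₀ →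
        (∀ ξ, ‖ξ‖ < (2 : ℝ) ^ (j - 1) ∨ (2 : ℝ) ^ (j + 1) < ‖ξ‖ → u₀ ξ = 0) →
      ∀ f : ℝ → EuclideanSpace ℝ (Fin d) → ℂ, Measurable (Function.uncurry f) →
        (∀ᵐ t ∂(volume.restrict {t : ℝ | 0 < t ∧ ENNReal.ofReal t < T}),
          ∀ ξ, ‖ξ‖ < (2 : ℝ) ^ (j - 1) ∨ (2 : ℝ) ^ (j + 1) < ‖ξ‖ → f t ξ = 0) →
      ENNReal.ofReal (ν ^ (1 / r).toReal * (2 : ℝ) ^ (2 * (j : ℝ) * (1 / r).toReal)) *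
          timeLp r {t : ℝ | 0 < t ∧ ENNReal.ofReal t < T}
            (fun t => eLpNorm
              (fun ξ => ((Real.exp (-(ν * t * ‖ξ‖ ^ 2)) : ℝ) : ℂ) * u₀ ξ +
                ∫ τ in (0 : ℝ)..t, ((Real.exp (-(ν * (t - τ) * ‖ξ‖ ^ 2)) : ℝ) : ℂ) * f τ ξ)
              q volume) ≤
        ENNReal.ofReal C * (eLpNorm u₀ q volume +
          ENNReal.ofReal (ν ^ (-1 + (1 / r₁).toReal) *
              (2 : ℝ) ^ (2 * (j : ℝ) * (-1 + (1 / r₁).toReal))) *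
            timeLp r₁ {t : ℝ | 0 < t ∧ ENNReal.ofReal t < T}
              (fun t => eLpNorm (f t) q volume)) := by
  have hr : 1 ≤ r := hr₁.trans hrr
  have hr0 : r ≠ 0 := (zero_lt_one.trans_le hr).ne'
  have hr₁0 : r₁ ≠ 0 := (zero_lt_one.trans_le hr₁).ne'
  refine ⟨16, by norm_num, ?_⟩
  intro d _ q hq ν hν j T _ u₀ hu₀ hu₀A f hf hfA
  set S : Set ℝ := {t : ℝ | 0 < t ∧ ENNReal.ofReal t < T}
  have hS : MeasurableSet S :=
    measurableSet_Ioi.inter (measurableSet_lt ENNReal.measurable_ofReal measurable_const)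
  set κ : ℝ := ν * (2 : ℝ) ^ (2 * (j : ℝ)) with hκdef
  have hκ : 0 < κ := by positivity
  have hκpow : ∀ x : ℝ, ν ^ x * (2 : ℝ) ^ (2 * (j : ℝ) * x) = κ ^ x := fun x => by
    rw [hκdef, Real.mul_rpow hν.le (by positivity), ← Real.rpow_mul (by norm_num)]
  rw [hκpow, hκpow, timeLp_eq_eLpNorm hr0, timeLp_eq_eLpNorm hr₁0]
  have ha : 0 < κ / 4 := by positivity
  set A : Set (EuclideanSpace ℝ (Fin d)) :=
    {ξ | (2 : ℝ) ^ (j - 1) ≤ ‖ξ‖ ∧ ‖ξ‖ ≤ (2 : ℝ) ^ (j + 1)}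
  have hA : ∀ ξ ∈ A, κ / 4 ≤ ν * ‖ξ‖ ^ 2 := fun ξ hξ => by
    have h1 : ((2 : ℝ) ^ (j - 1)) ^ 2 ≤ ‖ξ‖ ^ 2 := by
      gcongr
      exact hξ.1
    have h2 : (2 : ℝ) ^ (2 * (j : ℝ)) = ((2 : ℝ) ^ (j - 1)) ^ 2 * 4 := by
      rw [mul_comm, Real.rpow_mul (by norm_num), Real.rpow_intCast, zpow_sub_one₀ (by norm_num)]
      norm_num
      ring
    rw [hκdef, h2, mul_div_assoc, mul_div_cancel_right₀ _ (by norm_num)]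
    gcongr
  have hmem : ∀ ξ, ξ ∉ A → ‖ξ‖ < (2 : ℝ) ^ (j - 1) ∨ (2 : ℝ) ^ (j + 1) < ‖ξ‖ := fun ξ hξ => by
    simpa only [A, Set.mem_ofPred_eq, not_and_or, not_le] using hξ
  set k := expKernel (κ / 4)
  have hk : Measurable k := measurable_expKernel _
  have hk1 : ∀ s, k s ≤ 1 := expKernel_le_one ha
  have hk0 : ∀ s, 0 ≤ s → k s = ENNReal.ofReal (Real.exp (-(κ / 4 * s))) := fun s hs =>
    Set.indicator_of_mem (Set.mem_Ici.2 hs) _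
  set U := eLpNorm u₀ q volume
  set N : ℝ → ℝ≥0∞ := fun t => eLpNorm (f t) q volume
  have hN : Measurable N := by
    have := measurable_eLpNorm_curry (ρ := (volume : Measure (EuclideanSpace ℝ (Fin d))))
      (F := fun t ξ => ‖f t ξ‖ₑ) hf.enorm (zero_lt_one.trans_le hq).ne'
    simpa only [eLpNorm_enorm] using this
  have hg : Measurable (S.indicator N) := hN.indicator hS
  set h : ℝ → ℝ≥0∞ := fun t => ∫⁻ τ, k (t - τ) * S.indicator N τ
  have hh : Measurable h := Measurable.lintegral_prod_right'
    (f := fun z : ℝ × ℝ => k (z.1 - z.2) * S.indicator N z.2)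
    ((hk.comp (measurable_fst.sub measurable_snd)).mul (hg.comp measurable_snd))
  have hbound : ∀ t ∈ S, eLpNorm
      (fun ξ => ((Real.exp (-(ν * t * ‖ξ‖ ^ 2)) : ℝ) : ℂ) * u₀ ξ +
        ∫ τ in (0 : ℝ)..t, ((Real.exp (-(ν * (t - τ) * ‖ξ‖ ^ 2)) : ℝ) : ℂ) * f τ ξ)
      q volume ≤ k t * U + h t := fun t ht => by
    have hsub : Set.Ioc 0 t ⊆ S := fun τ hτ =>
      ⟨hτ.1, (ENNReal.ofReal_le_ofReal hτ.2).trans_lt ht.2⟩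
    have hfA' := hfA.filter_mono (ae_mono (Measure.restrict_mono hsub le_rfl))
    refine (eLpNorm_duhamel_le ht.1 hA hu₀ (fun ξ hξ => hu₀A ξ (hmem ξ hξ)) hf
      (hfA'.mono fun τ hτ ξ hξ => hτ ξ (hmem ξ hξ)) hq).trans ?_
    rw [hk0 t ht.1.le]
    gcongr
    refine le_trans ?_ (setLIntegral_le_lintegral (Set.Ioc 0 t) _)
    refine setLIntegral_mono' measurableSet_Ioc fun τ hτ => ?_
    rw [hk0 _ (sub_nonneg.2 hτ.2), Set.indicator_of_mem (hsub hτ)]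
  have hK : ∫⁻ s, k s = ENNReal.ofReal (κ / 4)⁻¹ := lintegral_expKernel ha
  have hx0 : 0 ≤ (1 / r).toReal := ENNReal.toReal_nonneg
  have hinv : ∀ p : ℝ≥0∞, 1 ≤ p → (1 / p).toReal ≤ 1 := fun p hp =>
    ENNReal.toReal_le_of_le_ofReal zero_le_one (by simpa using hp)
  have hx := hinv r hr
  have hy0 : 0 ≤ (1 / r₁).toReal := ENNReal.toReal_nonneg
  have hy := hinv r₁ hr₁
  have hnorm := calc
    eLpNorm (fun t => eLpNorm
      (fun ξ => ((Real.exp (-(ν * t * ‖ξ‖ ^ 2)) : ℝ) : ℂ) * u₀ ξ +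
        ∫ τ in (0 : ℝ)..t, ((Real.exp (-(ν * (t - τ) * ‖ξ‖ ^ 2)) : ℝ) : ℂ) * f τ ξ)
      q volume) r (volume.restrict S)
      ≤ eLpNorm (fun t => k t * U + h t) r (volume.restrict S) := by
        refine eLpNorm_mono_enorm_ae ?_
        filter_upwards [ae_restrict_mem hS] with t ht
        simpa only [enorm_eq_self] using hbound t ht
    _ ≤ eLpNorm (fun t => k t * U + h t) r volume :=
        eLpNorm_mono_measure _ Measure.restrict_le_self
    _ ≤ eLpNorm (fun t => k t * U) r volume + eLpNorm h r volume :=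
        eLpNorm_add_le_of_measurable (hk.mul_const U) hh hr
    _ ≤ ENNReal.ofReal (κ / 4)⁻¹ ^ (1 / r).toReal * U
          + ENNReal.ofReal (κ / 4)⁻¹ ^ (1 - (1 / r₁).toReal + (1 / r).toReal)
            * eLpNorm N r₁ (volume.restrict S) := by
        rw [← hK, ← eLpNorm_indicator_eq_eLpNorm_restrict hS]
        exact add_le_add (eLpNorm_mul_const_le hk hk1 hr U)
          (eLpNorm_lconvolution_le hk hg hk1 hr₁ hrr)
  refine (mul_le_mul_right hnorm _).trans ?_
  rw [mul_add, mul_add, ← mul_assoc, ← mul_assoc, ← mul_assoc]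
  refine add_le_add ?_ ?_
  · gcongr
    simpa using ofReal_mul_rpow_div_le (x := (1 / r).toReal) hκ hx0 (by linarith)
  · refine mul_le_mul' ((ofReal_mul_rpow_div_le hκ (by linarith) (by linarith)).trans_eq ?_) le_rfl
    ring_nf
end

section
/- Let d ≥ 1, s > 0, and 1 ≤ p, σ ≤ ∞ with p' the conjugate exponent of p. Then there exists a constant C > 0 such that for all F, G ∈ L¹(ℝ^d), ‖ { 2^{s j} ‖ψ_j (F∗G)‖_{L^{p'}(ℝ^d)} }_{j ∈ ℤ} ‖_{ℓ^σ} ≤ C ( ‖F‖_{L¹(ℝ^d)} · ‖ { 2^{s j} ‖ψ_j G‖_{L^{p'}} }_{j ∈ ℤ} ‖_{ℓ^σ} + ‖G‖_{L¹(ℝ^d)} · ‖ { 2^{s j} ‖ψ_j F‖_{L^{p'}} }_{j ∈ ℤ} ‖_{ℓ^σ} ), where (F∗G)(ξ) = ∫_{ℝ^d} F(ξ−η) G(η) dη. -/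
open MeasureTheory ENNReal

/-- The `ℓ^σ` norm (for `σ ∈ [1,∞]`, as an `ℝ≥0∞` exponent) of a `ℤ`-indexed family
of extended nonnegative reals. -/
noncomputable def seqLp (σ : ℝ≥0∞) (a : ℤ → ℝ≥0∞) : ℝ≥0∞ :=
  if σ = ∞ then ⨆ j, a j else (∑' j, a j ^ σ.toReal) ^ (1 / σ.toReal)

/-- Homogeneous Fourier–Besov norm (on the Fourier side), for a dyadic partition function
`ψ`: `‖ {2^{sj} ‖ψ_j F‖_{L^{p'}}}_j ‖_{ℓ^σ}` with `ψ_j(ξ) = ψ(2^{-j} ξ)`. -/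
noncomputable def fbNorm (d : ℕ) (ψ : EuclideanSpace ℝ (Fin d) → ℝ) (s : ℝ)
    (p' σ : ℝ≥0∞) (F : EuclideanSpace ℝ (Fin d) → ℂ) : ℝ≥0∞ :=
  seqLp σ fun j => ENNReal.ofReal ((2 : ℝ) ^ (s * (j : ℝ))) *
    eLpNorm (fun ξ => ψ ((2 : ℝ) ^ (-j) • ξ) • F ξ) p' volume

/-- Minkowski's inequality for countable sums of extended nonnegative functions. -/
theorem eLpNorm_tsum_le {α : Type*} {m : MeasurableSpace α} {μ : Measure α} {p : ℝ≥0∞}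
    (hp : 1 ≤ p) {f : ℕ → α → ℝ≥0∞} (hf : ∀ n, AEMeasurable (f n) μ) :
    eLpNorm (fun x => ∑' n, f n x) p μ ≤ ∑' n, eLpNorm (f n) p μ := by
  have hp0 : p ≠ 0 := (zero_lt_one.trans_le hp).ne'
  rcases eq_or_ne p ∞ with rfl | hpt
  · simp only [eLpNorm_exponent_top]
    refine eLpNormEssSup_le_of_ae_enorm_bound ?_
    have h : ∀ᵐ x ∂μ, ∀ n, ‖f n x‖ₑ ≤ eLpNormEssSup (f n) μ :=
      ae_all_iff.2 fun n => ae_le_eLpNormEssSup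
    filter_upwards [h] with x hx
    exact ENNReal.tsum_le_tsum hx
  · have hr : 0 < p.toReal := ENNReal.toReal_pos hp0 hpt
    have hsup : eLpNorm (fun x => ∑' n, f n x) p μ =
        ⨆ n, eLpNorm (fun x => ∑ i ∈ Finset.range n, f i x) p μ := by
      simp only [eLpNorm_eq_lintegral_rpow_enorm_toReal hp0 hpt, enorm_eq_self]
      have hmap := fun u : ℕ → ℝ≥0∞ =>
        (ENNReal.orderIsoRpow (1 / p.toReal) (by positivity)).map_iSup u
      simp only [ENNReal.orderIsoRpow_apply] at hmap
      rw [← hmap, ← lintegral_iSup']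
      · simp only [ENNReal.tsum_eq_iSup_nat]
        congr 2 with x
        exact (ENNReal.orderIsoRpow p.toReal hr).map_iSup _
      · exact fun n => (Finset.aemeasurable_fun_sum _ fun i _ => hf i).pow_const _
      · refine Filter.Eventually.of_forall fun x a b hab => ?_
        exact ENNReal.rpow_le_rpow
          (Finset.sum_le_sum_of_subset (Finset.range_mono hab)) hr.le
    rw [hsup]
    refine iSup_le fun n => ?_
    calc eLpNorm (fun x => ∑ i ∈ Finset.range n, f i x) p μ
        = eLpNorm (∑ i ∈ Finset.range n, f i) p μ := by
          congr 1 with x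
          simp
      _ ≤ ∑ i ∈ Finset.range n, eLpNorm (f i) p μ :=
          eLpNorm_sum_le (fun i _ => (hf i).aestronglyMeasurable) hp
      _ ≤ _ := ENNReal.sum_le_tsum _

theorem quasiMeasurePreserving_neg_add_const {G : Type*} [MeasurableSpace G] [AddGroup G]
    [MeasurableAdd₂ G] [MeasurableNeg G] (μ : Measure G) [μ.IsAddLeftInvariant]
    [μ.IsNegInvariant] (x : G) : Measure.QuasiMeasurePreserving (fun y => -y + x) μ μ := by
  have h : MeasurePreserving (fun y : G => -(-x + y)) μ μ :=
    (Measure.measurePreserving_neg μ).comp (measurePreserving_add_left μ (-x))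
  simpa using h.quasiMeasurePreserving

/-- Young's convolution inequality `‖f ⋆ g‖_p ≤ ‖f‖_1 ‖g‖_p`. -/
theorem eLpNorm_lconvolution_le_s18 {G : Type*} [MeasurableSpace G] [AddGroup G]
    [MeasurableAdd₂ G] [MeasurableNeg G] {μ : Measure G} [SFinite μ] [μ.IsAddLeftInvariant]
    [μ.IsNegInvariant] {p : ℝ≥0∞} (hp : 1 ≤ p) {f g : G → ℝ≥0∞} (hf : AEMeasurable f μ)
    (hg : AEMeasurable g μ) :
    eLpNorm (f ⋆ₗ[μ] g) p μ ≤ (∫⁻ x, f x ∂μ) * eLpNorm g p μ := by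
  have hp0 : p ≠ 0 := (zero_lt_one.trans_le hp).ne'
  have hqx := quasiMeasurePreserving_neg_add_const μ
  rcases eq_or_ne p ∞ with rfl | hpt
  · simp only [eLpNorm_exponent_top]
    refine eLpNormEssSup_le_of_ae_enorm_bound (Filter.Eventually.of_forall fun x => ?_)
    rw [enorm_eq_self, lconvolution_def, ← lintegral_mul_const'' _ hf]
    refine lintegral_mono_ae ?_
    filter_upwards [(hqx x).ae (ae_le_eLpNormEssSup (f := g))] with y hy
    exact mul_le_mul_right hy _
  · have hr : 0 < p.toReal := ENNReal.toReal_pos hp0 hpt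
    have hr1 : 1 ≤ p.toReal := by
      simpa using ENNReal.toReal_mono hpt hp
    set r := p.toReal with hrdef
    have hg2 : AEMeasurable (fun z : G × G => g (-z.1 + z.2)) (μ.prod μ) :=
      hg.comp_quasiMeasurePreserving (quasiMeasurePreserving_neg_add μ μ)
    have hpoint (x : G) : (f ⋆ₗ[μ] g) x ^ r ≤
        (∫⁻ y, f y ∂μ) ^ (r - 1) * ∫⁻ y, f y * g (-y + x) ^ r ∂μ := by
      have hgx : AEMeasurable (fun y => g (-y + x)) μ := hg.comp_quasiMeasurePreserving (hqx x)
      have key := ENNReal.lintegral_mul_norm_pow_le (μ := μ) hf (hf.mul (hgx.pow_const r))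
        (p := 1 - 1 / r) (q := 1 / r) (by
          rw [sub_nonneg, div_le_one hr]
          exact hr1) (by positivity) (by ring)
      have heq : (f ⋆ₗ[μ] g) x =
          ∫⁻ y, f y ^ (1 - 1 / r) * (f * fun y => g (-y + x) ^ r) y ^ (1 / r) ∂μ := by
        rw [lconvolution_def]
        congr 1 with y
        simp only [Pi.mul_apply]
        rw [ENNReal.mul_rpow_of_nonneg _ _ (by positivity), ← ENNReal.rpow_mul,
          mul_one_div_cancel hr.ne', ENNReal.rpow_one, ← mul_assoc,
          ← ENNReal.rpow_add_of_nonneg _ _ _ (by positivity)]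
        · simp
        · rw [sub_nonneg, div_le_one hr]
          exact hr1
      rw [← heq] at key
      refine (ENNReal.rpow_le_rpow key hr.le).trans_eq ?_
      rw [ENNReal.mul_rpow_of_nonneg _ _ hr.le, ← ENNReal.rpow_mul, ← ENNReal.rpow_mul,
        one_div_mul_cancel hr.ne', ENNReal.rpow_one]
      congr 2
      field_simp
    have hint : ∫⁻ x, (f ⋆ₗ[μ] g) x ^ r ∂μ ≤
        (∫⁻ y, f y ∂μ) ^ r * ∫⁻ x, g x ^ r ∂μ := by
      have hm : AEMeasurable (fun z : G × G => f z.1 * g (-z.1 + z.2) ^ r) (μ.prod μ) :=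
        hf.comp_fst.mul (hg2.pow_const r)
      calc ∫⁻ x, (f ⋆ₗ[μ] g) x ^ r ∂μ
          ≤ ∫⁻ x, (∫⁻ y, f y ∂μ) ^ (r - 1) * ∫⁻ y, f y * g (-y + x) ^ r ∂μ ∂μ :=
            lintegral_mono hpoint
        _ = (∫⁻ y, f y ∂μ) ^ (r - 1) * ∫⁻ x, ∫⁻ y, f y * g (-y + x) ^ r ∂μ ∂μ :=
            lintegral_const_mul'' _ hm.prod_swap.lintegral_prod_right'
        _ = (∫⁻ y, f y ∂μ) ^ (r - 1) * ∫⁻ y, ∫⁻ x, f y * g (-y + x) ^ r ∂μ ∂μ := by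
            rw [lintegral_lintegral_swap (f := fun y x => f y * g (-y + x) ^ r) hm]
        _ = (∫⁻ y, f y ∂μ) ^ (r - 1) * ∫⁻ y, f y * ∫⁻ x, g x ^ r ∂μ ∂μ := by
            congr 2 with y
            have hgy : AEMeasurable (fun x => g (-y + x)) μ :=
              hg.comp_quasiMeasurePreserving
                (measurePreserving_add_left μ (-y)).quasiMeasurePreserving
            rw [lintegral_const_mul'' _ (hgy.pow_const r),
              lintegral_add_left_eq_self (fun x => g x ^ r)]
        _ = (∫⁻ y, f y ∂μ) ^ r * ∫⁻ x, g x ^ r ∂μ := by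
            rw [lintegral_mul_const'' _ hf, ← mul_assoc]
            congr 1
            nth_rewrite 2 [← ENNReal.rpow_one (∫⁻ y, f y ∂μ)]
            rw [← ENNReal.rpow_add_of_nonneg _ _ (by linarith) zero_le_one, sub_add_cancel]
    simp only [eLpNorm_eq_lintegral_rpow_enorm_toReal hp0 hpt, enorm_eq_self, ← hrdef]
    refine (ENNReal.rpow_le_rpow hint (by positivity)).trans_eq ?_
    rw [ENNReal.mul_rpow_of_nonneg _ _ (by positivity), ← ENNReal.rpow_mul,
      mul_one_div_cancel hr.ne', ENNReal.rpow_one]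

theorem seqLp_eq_eLpNorm_count {σ : ℝ≥0∞} (hσ : σ ≠ 0) (a : ℤ → ℝ≥0∞) :
    seqLp σ a = eLpNorm a σ Measure.count := by
  unfold seqLp
  split_ifs with h
  · subst h
    simp [eLpNorm_exponent_top]
  · simp [eLpNorm_eq_lintegral_rpow_enorm_toReal hσ h, lintegral_count]

theorem seqLp_mono {σ : ℝ≥0∞} {a b : ℤ → ℝ≥0∞} (h : ∀ j, a j ≤ b j) :
    seqLp σ a ≤ seqLp σ b := by
  unfold seqLp
  split_ifs
  · exact iSup_mono h
  · gcongr with j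
    exact h j

theorem seqLp_add_le {σ : ℝ≥0∞} (hσ : 1 ≤ σ) (a b : ℤ → ℝ≥0∞) :
    seqLp σ (fun j => a j + b j) ≤ seqLp σ a + seqLp σ b := by
  simp only [seqLp_eq_eLpNorm_count (zero_lt_one.trans_le hσ).ne']
  exact eLpNorm_add_le (measurable_of_countable a).aestronglyMeasurable
    (measurable_of_countable b).aestronglyMeasurable hσ

theorem seqLp_tsum_le {σ : ℝ≥0∞} (hσ : 1 ≤ σ) (a : ℕ → ℤ → ℝ≥0∞) :
    seqLp σ (fun j => ∑' n, a n j) ≤ ∑' n, seqLp σ (a n) := by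
  simp only [seqLp_eq_eLpNorm_count (zero_lt_one.trans_le hσ).ne']
  exact eLpNorm_tsum_le hσ fun n => (measurable_of_countable (a n)).aemeasurable

theorem seqLp_const_mul {σ : ℝ≥0∞} (hσ : σ ≠ 0) (c : ℝ≥0∞) (a : ℤ → ℝ≥0∞) :
    seqLp σ (fun j => c * a j) = c * seqLp σ a := by
  unfold seqLp
  split_ifs with h
  · rw [ENNReal.mul_iSup]
  · have hr : 0 < σ.toReal := ENNReal.toReal_pos hσ h
    simp only [ENNReal.mul_rpow_of_nonneg _ _ hr.le, ENNReal.tsum_mul_left]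
    rw [ENNReal.mul_rpow_of_nonneg _ _ (by positivity), ← ENNReal.rpow_mul,
      mul_one_div_cancel hr.ne', ENNReal.rpow_one]

theorem seqLp_add_right {σ : ℝ≥0∞} (a : ℤ → ℝ≥0∞) (m : ℤ) :
    seqLp σ (fun j => a (j + m)) = seqLp σ a := by
  unfold seqLp
  split_ifs with h
  · exact (Equiv.addRight m).iSup_comp (g := a)
  · rw [← (Equiv.addRight m).tsum_eq (fun j => a j ^ σ.toReal)]
    rfl

/-- Weighted sums over the frequencies above `j - 3` are bounded on `ℓ^σ`. -/
theorem seqLp_high_frequency_tsum_le {σ : ℝ≥0∞} (hσ : 1 ≤ σ) (s : ℝ) (a : ℤ → ℝ≥0∞) :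
    seqLp σ (fun j => ENNReal.ofReal ((2 : ℝ) ^ (s * (j : ℝ))) * ∑' n : ℕ, a (j + (n - 3))) ≤
      (∑' n : ℕ, ENNReal.ofReal ((2 : ℝ) ^ (-(s * ((n : ℝ) - 3))))) *
        seqLp σ (fun j => ENNReal.ofReal ((2 : ℝ) ^ (s * (j : ℝ))) * a j) := by
  have hσ0 : σ ≠ 0 := (zero_lt_one.trans_le hσ).ne'
  set b : ℤ → ℝ≥0∞ := fun j => ENNReal.ofReal ((2 : ℝ) ^ (s * (j : ℝ))) * a j with hb
  have heq : (fun j : ℤ => ENNReal.ofReal ((2 : ℝ) ^ (s * (j : ℝ))) *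
      ∑' n : ℕ, a (j + (n - 3))) = fun j => ∑' n : ℕ,
        ENNReal.ofReal ((2 : ℝ) ^ (-(s * ((n : ℝ) - 3)))) * b (j + ((n : ℤ) - 3)) := by
    ext j
    rw [← ENNReal.tsum_mul_left]
    congr 1 with n
    rw [hb, ← mul_assoc, ← ENNReal.ofReal_mul (by positivity), ← Real.rpow_add two_pos]
    congr 3
    push_cast
    ring_nf
  rw [heq, ← ENNReal.tsum_mul_right]
  refine (seqLp_tsum_le hσ _).trans_eq ?_
  congr 1 with n
  rw [seqLp_const_mul hσ0, seqLp_add_right]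

theorem summable_two_rpow_neg {s : ℝ} (hs : 0 < s) :
    Summable fun n : ℕ => (2 : ℝ) ^ (-(s * ((n : ℝ) - 3))) := by
  have h : Summable fun n : ℕ => (2 : ℝ) ^ (3 * s) * ((2 : ℝ) ^ (-s)) ^ n :=
    (summable_geometric_of_lt_one (by positivity)
      (Real.rpow_lt_one_of_one_lt_of_neg _root_.one_lt_two (by linarith))).mul_left _
  refine h.congr fun n => ?_
  rw [← Real.rpow_natCast, ← Real.rpow_mul two_pos.le, ← Real.rpow_add two_pos]
  ring_nf

section DyadicPartition

variable {E : Type*} [NormedAddCommGroup E] [NormedSpace ℝ E] {ψ : E → ℝ}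

/-- A vector of norm at least `2 ^ (j - 2)` only meets the dyadic pieces of index at least
`j - 3`. -/
theorem enorm_le_tsum_dyadic (hψ01 : ∀ ξ, ψ ξ ∈ Set.Icc (0 : ℝ) 1)
    (hψsupp : ∀ ξ, ψ ξ ≠ 0 → 1 / 2 ≤ ‖ξ‖ ∧ ‖ξ‖ ≤ 2)
    (hψsum : ∀ ξ : E, ξ ≠ 0 → ∑' j : ℤ, ψ ((2 : ℝ) ^ (-j) • ξ) = 1)
    (G : E → ℂ) {j : ℤ} {η : E} (hη : (2 : ℝ) ^ (j - 2) ≤ ‖η‖) :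
    ‖G η‖ₑ ≤ ∑' n : ℕ, ‖ψ ((2 : ℝ) ^ (-(j + ((n : ℤ) - 3))) • η) • G η‖ₑ := by
  have hη0 : η ≠ 0 := norm_pos_iff.1 (lt_of_lt_of_le (by positivity) hη)
  have hsum := hψsum η hη0
  have hsummable : Summable fun k : ℤ => ψ ((2 : ℝ) ^ (-k) • η) := by
    by_contra h
    rw [tsum_eq_zero_of_not_summable h] at hsum
    exact zero_ne_one hsum
  have hinj : Function.Injective fun n : ℕ => j + ((n : ℤ) - 3) := fun a b h => by
    simp only at h
    omega
  have hsupp : (Function.support fun k : ℤ => ENNReal.ofReal (ψ ((2 : ℝ) ^ (-k) • η))) ⊆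
      Set.range fun n : ℕ => j + ((n : ℤ) - 3) := by
    intro k hk
    have hk0 : ψ ((2 : ℝ) ^ (-k) • η) ≠ 0 := fun h =>
      hk (by simp only [h, ENNReal.ofReal_zero])
    have h2 := (hψsupp _ hk0).2
    rw [norm_smul, Real.norm_of_nonneg (by positivity), zpow_neg, inv_mul_le_iff₀ (by positivity),
      ← zpow_add_one₀ two_ne_zero] at h2
    have h3 : j - 2 ≤ k + 1 := (zpow_le_zpow_iff_right₀ _root_.one_lt_two).1 (hη.trans h2)
    exact ⟨(k - j + 3).toNat, by simp only; omega⟩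
  have hone : ∑' n : ℕ, ENNReal.ofReal (ψ ((2 : ℝ) ^ (-(j + ((n : ℤ) - 3))) • η)) = 1 := by
    rw [hinj.tsum_eq hsupp, ← ENNReal.ofReal_tsum_of_nonneg (fun k => (hψ01 _).1) hsummable, hsum,
      ENNReal.ofReal_one]
  have hterm (n : ℕ) : ‖ψ ((2 : ℝ) ^ (-(j + ((n : ℤ) - 3))) • η) • G η‖ₑ =
      ENNReal.ofReal (ψ ((2 : ℝ) ^ (-(j + ((n : ℤ) - 3))) • η)) * ‖G η‖ₑ := by
    rw [enorm_smul, Real.enorm_of_nonneg (hψ01 _).1]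
  simp only [hterm]
  rw [ENNReal.tsum_mul_right, hone, one_mul]

/-- The `j`-th dyadic piece of a convolution only sees frequencies above `j - 3` of one of the
two factors. -/
theorem enorm_dyadic_convolution_le [MeasurableSpace E] [BorelSpace E]
    [SecondCountableTopology E] {μ : Measure E} [SFinite μ] [μ.IsAddLeftInvariant]
    [μ.IsNegInvariant]
    (hψm : Measurable ψ) (hψ01 : ∀ ξ, ψ ξ ∈ Set.Icc (0 : ℝ) 1)
    (hψsupp : ∀ ξ, ψ ξ ≠ 0 → 1 / 2 ≤ ‖ξ‖ ∧ ‖ξ‖ ≤ 2)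
    (hψsum : ∀ ξ : E, ξ ≠ 0 → ∑' j : ℤ, ψ ((2 : ℝ) ^ (-j) • ξ) = 1)
    {F G : E → ℂ} (hF : AEStronglyMeasurable F μ) (hG : AEStronglyMeasurable G μ)
    (j : ℤ) (ξ : E) :
    ‖ψ ((2 : ℝ) ^ (-j) • ξ) • ∫ η, F (ξ - η) * G η ∂μ‖ₑ ≤
      ((fun x => ‖F x‖ₑ) ⋆ₗ[μ] fun η =>
        ∑' n : ℕ, ‖ψ ((2 : ℝ) ^ (-(j + ((n : ℤ) - 3))) • η) • G η‖ₑ) ξ +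
      ((fun x => ‖G x‖ₑ) ⋆ₗ[μ] fun η =>
        ∑' n : ℕ, ‖ψ ((2 : ℝ) ^ (-(j + ((n : ℤ) - 3))) • η) • F η‖ₑ) ξ := by
  rcases eq_or_ne (ψ ((2 : ℝ) ^ (-j) • ξ)) 0 with h0 | h0
  · rw [h0, zero_smul, enorm_zero]
    exact zero_le
  have hξ : (2 : ℝ) ^ (j - 1) ≤ ‖ξ‖ := by
    have h1 := (hψsupp _ h0).1
    rw [norm_smul, Real.norm_of_nonneg (by positivity), zpow_neg, le_inv_mul_iff₀ (by positivity)]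
      at h1
    rw [zpow_sub_one₀ two_ne_zero]
    linarith
  rw [lconvolution_comm (f := fun x => ‖F x‖ₑ)]
  simp only [lconvolution_def]
  have hGm : AEMeasurable (fun η => ∑' n : ℕ,
      ‖ψ ((2 : ℝ) ^ (-(j + ((n : ℤ) - 3))) • η) • G η‖ₑ) μ := by
    refine AEMeasurable.tsum fun n => AEStronglyMeasurable.enorm ?_
    exact (hψm.comp (measurable_const_smul _)).aestronglyMeasurable.smul hG
  have hFm : AEMeasurable (fun η => ‖F (-η + ξ)‖ₑ) μ :=
    hF.enorm.comp_quasiMeasurePreserving (quasiMeasurePreserving_neg_add_const μ ξ)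
  have hGF : AEMeasurable (fun η => (∑' n : ℕ,
      ‖ψ ((2 : ℝ) ^ (-(j + ((n : ℤ) - 3))) • η) • G η‖ₑ) * ‖F (-η + ξ)‖ₑ) μ := hGm.mul hFm
  rw [← lintegral_add_left' hGF]
  calc ‖ψ ((2 : ℝ) ^ (-j) • ξ) • ∫ η, F (ξ - η) * G η ∂μ‖ₑ
      ≤ 1 * ‖∫ η, F (ξ - η) * G η ∂μ‖ₑ := by
        rw [enorm_smul, Real.enorm_of_nonneg (hψ01 _).1]
        gcongr
        exact ENNReal.ofReal_le_one.2 (hψ01 _).2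
    _ ≤ ∫⁻ η, ‖F (ξ - η) * G η‖ₑ ∂μ := by
        rw [one_mul]
        exact enorm_integral_le_lintegral_enorm _
    _ ≤ _ := by
        refine lintegral_mono fun η => ?_
        have hsub : ξ - η = -η + ξ := sub_eq_neg_add ξ η
        rw [hsub, enorm_mul]
        have hsplit : (2 : ℝ) ^ (j - 2) ≤ ‖η‖ ∨ (2 : ℝ) ^ (j - 2) ≤ ‖-η + ξ‖ := by
          by_contra! h
          have h3 : ‖ξ‖ ≤ ‖η‖ + ‖-η + ξ‖ := by
            simpa using norm_add_le η (-η + ξ)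
          have h4 : (2 : ℝ) ^ (j - 1) = 2 ^ (j - 2) * 2 := by
            rw [← zpow_add_one₀ two_ne_zero]
            ring_nf
          linarith [h.1, h.2]
        rcases hsplit with h | h
        · refine le_add_right ?_
          rw [mul_comm]
          exact mul_le_mul_left (enorm_le_tsum_dyadic hψ01 hψsupp hψsum G h) _
        · refine le_add_left ?_
          rw [mul_comm]
          exact mul_le_mul_right (enorm_le_tsum_dyadic hψ01 hψsupp hψsum F h) _

/-- `L^q` bound for a dyadic piece of a convolution. -/
theorem eLpNorm_dyadic_convolution_le [MeasurableSpace E] [BorelSpace E]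
    [SecondCountableTopology E] {μ : Measure E} [SFinite μ] [μ.IsAddLeftInvariant]
    [μ.IsNegInvariant]
    (hψm : Measurable ψ) (hψ01 : ∀ ξ, ψ ξ ∈ Set.Icc (0 : ℝ) 1)
    (hψsupp : ∀ ξ, ψ ξ ≠ 0 → 1 / 2 ≤ ‖ξ‖ ∧ ‖ξ‖ ≤ 2)
    (hψsum : ∀ ξ : E, ξ ≠ 0 → ∑' j : ℤ, ψ ((2 : ℝ) ^ (-j) • ξ) = 1)
    {F G : E → ℂ} (hF : AEStronglyMeasurable F μ) (hG : AEStronglyMeasurable G μ)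
    {q : ℝ≥0∞} (hq : 1 ≤ q) (j : ℤ) :
    eLpNorm (fun ξ => ψ ((2 : ℝ) ^ (-j) • ξ) • ∫ η, F (ξ - η) * G η ∂μ) q μ ≤
      eLpNorm F 1 μ * ∑' n : ℕ,
        eLpNorm (fun ξ => ψ ((2 : ℝ) ^ (-(j + ((n : ℤ) - 3))) • ξ) • G ξ) q μ +
      eLpNorm G 1 μ * ∑' n : ℕ,
        eLpNorm (fun ξ => ψ ((2 : ℝ) ^ (-(j + ((n : ℤ) - 3))) • ξ) • F ξ) q μ := by
  have hm {H : E → ℂ} (hH : AEStronglyMeasurable H μ) (n : ℕ) :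
      AEMeasurable (fun η => ‖ψ ((2 : ℝ) ^ (-(j + ((n : ℤ) - 3))) • η) • H η‖ₑ) μ :=
    ((hψm.comp (measurable_const_smul _)).aestronglyMeasurable.smul hH).enorm
  have hyoung {H K : E → ℂ} (hH : AEStronglyMeasurable H μ) (hK : AEStronglyMeasurable K μ) :
      eLpNorm ((fun x => ‖H x‖ₑ) ⋆ₗ[μ] fun η =>
        ∑' n : ℕ, ‖ψ ((2 : ℝ) ^ (-(j + ((n : ℤ) - 3))) • η) • K η‖ₑ) q μ ≤
      eLpNorm H 1 μ * ∑' n : ℕ,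
        eLpNorm (fun ξ => ψ ((2 : ℝ) ^ (-(j + ((n : ℤ) - 3))) • ξ) • K ξ) q μ := by
    refine (eLpNorm_lconvolution_le_s18 hq hH.enorm (AEMeasurable.tsum (hm hK))).trans ?_
    rw [eLpNorm_one_eq_lintegral_enorm]
    gcongr
    refine (eLpNorm_tsum_le hq (hm hK)).trans_eq ?_
    simp only [eLpNorm_enorm]
  refine le_trans (eLpNorm_mono_enorm
    (g := ((fun x => ‖F x‖ₑ) ⋆ₗ[μ] fun η =>
        ∑' n : ℕ, ‖ψ ((2 : ℝ) ^ (-(j + ((n : ℤ) - 3))) • η) • G η‖ₑ) +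
      ((fun x => ‖G x‖ₑ) ⋆ₗ[μ] fun η =>
        ∑' n : ℕ, ‖ψ ((2 : ℝ) ^ (-(j + ((n : ℤ) - 3))) • η) • F η‖ₑ))
    fun ξ => enorm_dyadic_convolution_le hψm hψ01 hψsupp hψsum hF hG j ξ) ?_
  refine (eLpNorm_add_le ?_ ?_ hq).trans (add_le_add (hyoung hF hG) (hyoung hG hF))
  · exact (aemeasurable_lconvolution hF.enorm
      (AEMeasurable.tsum (hm hG))).aestronglyMeasurable
  · exact (aemeasurable_lconvolution hG.enorm
      (AEMeasurable.tsum (hm hF))).aestronglyMeasurable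

end DyadicPartition

/-- Fourier-side bilinear estimate: for `s > 0`, `1 ≤ p, σ ≤ ∞` (conjugacy
`1/p + 1/p' = 1` in `ℝ≥0∞` encodes `1 ≤ p ≤ ∞`), there is `C > 0` such that for
`F, G ∈ L¹`, `‖F∗G‖_{\widehat{\dot B}^s_{p,σ}}
 ≤ C (‖F‖_{L¹} ‖G‖_{\widehat{\dot B}^s_{p,σ}} + ‖G‖_{L¹} ‖F‖_{\widehat{\dot B}^s_{p,σ}})`,
the Fourier-side form of
`‖fg‖ ≲ ‖f‖_{\widehat L^∞}‖g‖ + ‖f‖‖g‖_{\widehat L^∞}`. -/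
theorem stmt18 (d : ℕ) (hd : 1 ≤ d) (s : ℝ) (hs : 0 < s)
    (p p' σ : ℝ≥0∞) (hpc : 1 / p + 1 / p' = 1) (hσ : 1 ≤ σ)
    (ψ : EuclideanSpace ℝ (Fin d) → ℝ) (hψm : Measurable ψ)
    (hψ01 : ∀ ξ, ψ ξ ∈ Set.Icc (0 : ℝ) 1)
    (hψsupp : ∀ ξ, ψ ξ ≠ 0 → 1 / 2 ≤ ‖ξ‖ ∧ ‖ξ‖ ≤ 2)
    (hψsum : ∀ ξ : EuclideanSpace ℝ (Fin d), ξ ≠ 0 → ∑' j : ℤ, ψ ((2 : ℝ) ^ (-j) • ξ) = 1) :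
    ∃ C > 0, ∀ F G : EuclideanSpace ℝ (Fin d) → ℂ, Integrable F → Integrable G →
      fbNorm d ψ s p' σ (fun ξ => ∫ η, F (ξ - η) * G η) ≤
        ENNReal.ofReal C * (eLpNorm F 1 volume * fbNorm d ψ s p' σ G +
          eLpNorm G 1 volume * fbNorm d ψ s p' σ F) := by
  have hσ0 : σ ≠ 0 := (zero_lt_one.trans_le hσ).ne'
  have hp' : 1 ≤ p' := by
    have h : 1 / p' ≤ 1 := le_add_self.trans_eq hpc
    simpa using h
  have hsummable := summable_two_rpow_neg hs
  refine ⟨∑' n : ℕ, (2 : ℝ) ^ (-(s * ((n : ℝ) - 3))),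
    hsummable.tsum_pos (fun n => by positivity) 0 (by positivity), fun F G hF hG => ?_⟩
  rw [ENNReal.ofReal_tsum_of_nonneg (fun n => by positivity) hsummable]
  unfold fbNorm
  set w : ℤ → ℝ≥0∞ := fun j => ENNReal.ofReal ((2 : ℝ) ^ (s * (j : ℝ))) with hw
  set N : (EuclideanSpace ℝ (Fin d) → ℂ) → ℤ → ℝ≥0∞ := fun H j =>
    eLpNorm (fun ξ => ψ ((2 : ℝ) ^ (-j) • ξ) • H ξ) p' volume with hN
  set K : ℝ≥0∞ := ∑' n : ℕ, ENNReal.ofReal ((2 : ℝ) ^ (-(s * ((n : ℝ) - 3)))) with hK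
  calc seqLp σ (fun j => w j * N (fun ξ => ∫ η, F (ξ - η) * G η) j)
      ≤ seqLp σ (fun j => eLpNorm F 1 volume * (w j * ∑' n : ℕ, N G (j + (n - 3))) +
          eLpNorm G 1 volume * (w j * ∑' n : ℕ, N F (j + (n - 3)))) := by
        refine seqLp_mono fun j => ?_
        rw [mul_left_comm _ (w j), mul_left_comm _ (w j), ← mul_add]
        exact mul_le_mul_right (eLpNorm_dyadic_convolution_le hψm hψ01 hψsupp hψsum
          hF.aestronglyMeasurable hG.aestronglyMeasurable hp' j) _
    _ ≤ eLpNorm F 1 volume * seqLp σ (fun j => w j * ∑' n : ℕ, N G (j + (n - 3))) +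
          eLpNorm G 1 volume * seqLp σ (fun j => w j * ∑' n : ℕ, N F (j + (n - 3))) := by
        refine (seqLp_add_le hσ _ _).trans_eq ?_
        rw [seqLp_const_mul hσ0, seqLp_const_mul hσ0]
    _ ≤ eLpNorm F 1 volume * (K * seqLp σ (fun j => w j * N G j)) +
          eLpNorm G 1 volume * (K * seqLp σ (fun j => w j * N F j)) := by
        gcongr
        · exact seqLp_high_frequency_tsum_le hσ s (N G)
        · exact seqLp_high_frequency_tsum_le hσ s (N F)
    _ = _ := by
        rw [mul_add, mul_left_comm K, mul_left_comm K]
end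

section
/- Let d ≥ 1, 1 ≤ p, σ ≤ ∞ with p' the conjugate exponent of p, and let s ∈ ℝ satisfy |s| < d/p if p ≥ 2, and −d/p' < s < d/p if 1 ≤ p < 2. Then there exists a constant C > 0 such that for all F, G ∈ L¹(ℝ^d), ‖ { 2^{s j} ‖ψ_j (F∗G)‖_{L^{p'}(ℝ^d)} }_{j ∈ ℤ} ‖_{ℓ^σ} ≤ C ‖ { 2^{s j} ‖ψ_j F‖_{L^{p'}} }_{j ∈ ℤ} ‖_{ℓ^σ} · ( ‖G‖_{L¹(ℝ^d)} + sup_{k ∈ ℤ} 2^{(d/p) k} ‖ψ_k G‖_{L^{p'}(ℝ^d)} ), where (F∗G)(ξ) = ∫_{ℝ^d} F(ξ−η) G(η) dη. -/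
open MeasureTheory ENNReal

namespace FourierBesov

section Lp

variable {α : Type*} [MeasurableSpace α] {μ : Measure α}

lemma eLpNorm_eq_lintegral_rpow {q : ℝ≥0∞} (h0 : q ≠ 0) (ht : q ≠ ∞) (f : α → ℝ≥0∞) :
    eLpNorm f q μ = (∫⁻ x, f x ^ q.toReal ∂μ) ^ (1 / q.toReal) := by
  simpa only [enorm_eq_self] using
    eLpNorm_eq_lintegral_rpow_enorm_toReal (μ := μ) h0 ht (f := f)

lemma eLpNorm_le_iff_lintegral_rpow_le {q : ℝ≥0∞} (h0 : q ≠ 0) (ht : q ≠ ∞) (f : α → ℝ≥0∞)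
    (c : ℝ≥0∞) : eLpNorm f q μ ≤ c ↔ ∫⁻ x, f x ^ q.toReal ∂μ ≤ c ^ q.toReal := by
  rw [eLpNorm_eq_lintegral_rpow h0 ht, one_div,
    ENNReal.rpow_inv_le_iff (ENNReal.toReal_pos h0 ht)]

lemma eLpNorm_rpow_toReal {q : ℝ≥0∞} (h0 : q ≠ 0) (ht : q ≠ ∞) (f : α → ℝ≥0∞) :
    eLpNorm f q μ ^ q.toReal = ∫⁻ x, f x ^ q.toReal ∂μ := by
  rw [eLpNorm_eq_lintegral_rpow h0 ht, one_div,
    ENNReal.rpow_inv_rpow (ENNReal.toReal_pos h0 ht).ne']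

lemma eLpNorm_mono_fun {q : ℝ≥0∞} {f g : α → ℝ≥0∞} (h : ∀ x, f x ≤ g x) :
    eLpNorm f q μ ≤ eLpNorm g q μ :=
  eLpNorm_mono_enorm fun x => by simpa only [enorm_eq_self] using h x

/-- Hölder's inequality for `ℝ≥0∞`-valued functions, endpoint `q = ∞` included. -/
lemma lintegral_mul_le_eLpNorm_mul_eLpNorm {p q : ℝ≥0∞} (hpq : 1 / p + 1 / q = 1) (hp : p ≠ ∞)
    {f g : α → ℝ≥0∞} (hf : Measurable f) (hg : Measurable g) :
    ∫⁻ x, f x * g x ∂μ ≤ eLpNorm f q μ * eLpNorm g p μ := by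
  rcases eq_or_ne q ∞ with rfl | hq
  · have hp1 : p = 1 := by simpa using hpq
    subst hp1
    rw [eLpNorm_exponent_top, eLpNorm_one_eq_lintegral_enorm, ← lintegral_const_mul _ (by fun_prop)]
    refine lintegral_mono_ae ?_
    filter_upwards [enorm_ae_le_eLpNormEssSup f μ] with x hx
    simp only [enorm_eq_self] at hx ⊢
    gcongr
  · have hp0 : p ≠ 0 := by rintro rfl; simp at hpq
    have hq0 : q ≠ 0 := by rintro rfl; simp at hpq
    have hr : q.toReal.HolderConjugate p.toReal := by
      have h1 := congrArg ENNReal.toReal hpq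
      rw [ENNReal.toReal_add (by simpa using hp0) (by simpa using hq0)] at h1
      simp only [one_div, ENNReal.toReal_inv, ENNReal.toReal_one] at h1
      exact ⟨by rw [inv_one]; linarith, ENNReal.toReal_pos hq0 hq, ENNReal.toReal_pos hp0 hp⟩
    rw [eLpNorm_eq_lintegral_rpow hq0 hq, eLpNorm_eq_lintegral_rpow hp0 hp]
    exact ENNReal.lintegral_mul_le_Lp_mul_Lq μ hr hf.aemeasurable hg.aemeasurable

/-- Minkowski's inequality for countable sums of `ℝ≥0∞`-valued functions. -/
lemma eLpNorm_tsum_le {ι : Type*} [Countable ι] {q : ℝ≥0∞} (hq : 1 ≤ q) {f : ι → α → ℝ≥0∞}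
    (hf : ∀ i, Measurable (f i)) :
    eLpNorm (fun x => ∑' i, f i x) q μ ≤ ∑' i, eLpNorm (f i) q μ := by
  classical
  rcases eq_or_ne q ∞ with rfl | hqt
  · simp only [eLpNorm_exponent_top]
    refine essSup_le_of_ae_le _ ?_
    filter_upwards [ae_all_iff.2 fun i => enorm_ae_le_eLpNormEssSup (f i) μ] with x hx
    exact ENNReal.tsum_le_tsum hx
  · have hq0 : q ≠ 0 := (zero_lt_one.trans_le hq).ne'
    have hpos := ENNReal.toReal_pos hq0 hqt
    rw [eLpNorm_le_iff_lintegral_rpow_le hq0 hqt]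
    have h1 : ∀ x, (∑' i, f i x) ^ q.toReal = ⨆ s : Finset ι, (∑ i ∈ s, f i x) ^ q.toReal := by
      intro x
      rw [ENNReal.tsum_eq_iSup_sum]
      exact (ENNReal.orderIsoRpow q.toReal hpos).map_iSup _
    simp only [h1]
    rw [lintegral_iSup_directed]
    · refine iSup_le fun s => ?_
      rw [← eLpNorm_le_iff_lintegral_rpow_le hq0 hqt]
      have h2 := eLpNorm_sum_le (μ := μ) (s := s) (f := f)
        (fun i _ => (hf i).aestronglyMeasurable) hq
      refine le_trans (le_of_eq ?_) (h2.trans (ENNReal.sum_le_tsum s))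
      congr 1
      ext x
      simp
    · intro s
      exact ((Finset.measurable_sum s fun i _ => hf i).pow_const _).aemeasurable
    · refine directed_of_isDirected_le fun s t hst x => ?_
      dsimp only
      gcongr

end Lp

section Convolution

variable {G : Type*} [AddCommGroup G] [MeasurableSpace G] [MeasurableAdd₂ G] [MeasurableNeg G]
  {μ : Measure G}

lemma measurable_sub_mul {f g : G → ℝ≥0∞} (hf : Measurable f) (hg : Measurable g) :
    Measurable (Function.uncurry fun x y => f (x - y) * g y) :=
  (hf.comp (measurable_fst.sub measurable_snd)).mul (hg.comp measurable_snd)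

lemma measurable_lintegral_sub_mul [SFinite μ] {f g : G → ℝ≥0∞} (hf : Measurable f)
    (hg : Measurable g) : Measurable fun x => ∫⁻ y, f (x - y) * g y ∂μ :=
  (measurable_sub_mul hf hg).lintegral_prod_right

variable [μ.IsAddLeftInvariant]

lemma lintegral_lintegral_sub_mul [SFinite μ] {f g : G → ℝ≥0∞} (hf : Measurable f)
    (hg : Measurable g) :
    ∫⁻ x, ∫⁻ y, f (x - y) * g y ∂μ ∂μ = (∫⁻ x, f x ∂μ) * ∫⁻ y, g y ∂μ := by
  rw [lintegral_lintegral_swap (measurable_sub_mul hf hg).aemeasurable,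
    ← lintegral_const_mul _ hg]
  refine lintegral_congr fun y => ?_
  rw [lintegral_mul_const _ (by fun_prop), lintegral_sub_right_eq_self]

variable [μ.IsNegInvariant]

lemma lintegral_sub_mul_comm (f g : G → ℝ≥0∞) (x : G) :
    ∫⁻ y, f (x - y) * g y ∂μ = ∫⁻ y, g (x - y) * f y ∂μ := by
  rw [← lintegral_sub_left_eq_self _ x]
  simp [mul_comm]

lemma eLpNorm_sub_left {f : G → ℝ≥0∞} (hf : Measurable f) (q : ℝ≥0∞) (x : G) :
    eLpNorm (fun y => f (x - y)) q μ = eLpNorm f q μ :=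
  eLpNorm_comp_measurePreserving hf.aestronglyMeasurable (Measure.measurePreserving_sub_left μ x)

/-- Young's inequality `L^q * L^1 ⊆ L^q`. -/
lemma eLpNorm_lintegral_sub_mul_le [SFinite μ] {f g : G → ℝ≥0∞} (hf : Measurable f)
    (hg : Measurable g) {q : ℝ≥0∞} (hq : 1 ≤ q) :
    eLpNorm (fun x => ∫⁻ y, f (x - y) * g y ∂μ) q μ ≤ eLpNorm f q μ * ∫⁻ y, g y ∂μ := by
  rcases eq_or_ne q ∞ with rfl | hqt
  · rw [eLpNorm_exponent_top]
    refine essSup_le_of_ae_le _ (Filter.Eventually.of_forall fun x => ?_)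
    have := lintegral_mul_le_eLpNorm_mul_eLpNorm (μ := μ) (p := 1) (q := ∞) (by simp) (by simp)
      (hf.comp (measurable_const.sub measurable_id : Measurable fun y : G => x - y)) hg
    simp only [Function.comp_apply, eLpNorm_one_eq_lintegral_enorm, enorm_eq_self] at this ⊢
    exact this.trans_eq (by rw [← eLpNorm_sub_left hf ∞ x]; rfl)
  · have hq0 : q ≠ 0 := (zero_lt_one.trans_le hq).ne'
    have hpos := ENNReal.toReal_pos hq0 hqt
    have hq1 : 1 ≤ q.toReal := by simpa using ENNReal.toReal_mono hqt hq
    rw [eLpNorm_le_iff_lintegral_rpow_le hq0 hqt, ENNReal.mul_rpow_of_nonneg _ _ hpos.le,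
      eLpNorm_rpow_toReal hq0 hqt]
    set r := q.toReal
    have hr : r⁻¹ ≤ 1 := inv_le_one_of_one_le₀ hq1
    have hfr : Measurable fun x => f x ^ r := hf.pow_const r
    have key : ∀ x, (∫⁻ y, f (x - y) * g y ∂μ) ^ r ≤
        (∫⁻ y, f (x - y) ^ r * g y ∂μ) * (∫⁻ y, g y ∂μ) ^ (r - 1) := by
      intro x
      have h := ENNReal.lintegral_mul_norm_pow_le (μ := μ) (f := fun y => f (x - y) ^ r * g y)
        (g := g) (by fun_prop) hg.aemeasurable (p := r⁻¹) (q := 1 - r⁻¹) (by positivity)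
        (by linarith) (by ring)
      have h' : ∀ y, (f (x - y) ^ r * g y) ^ r⁻¹ * g y ^ (1 - r⁻¹) = f (x - y) * g y := by
        intro y
        rw [ENNReal.mul_rpow_of_nonneg _ _ (by positivity), ENNReal.rpow_rpow_inv hpos.ne',
          mul_assoc, ← ENNReal.rpow_add_of_nonneg _ _ (by positivity) (by linarith)]
        simp
      simp only [h'] at h
      refine (ENNReal.rpow_le_rpow h hpos.le).trans_eq ?_
      rw [ENNReal.mul_rpow_of_nonneg _ _ hpos.le, ENNReal.rpow_inv_rpow hpos.ne',
        ← ENNReal.rpow_mul]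
      congr 2
      field_simp
    refine (lintegral_mono key).trans_eq ?_
    rw [lintegral_mul_const _ (measurable_lintegral_sub_mul hfr hg),
      lintegral_lintegral_sub_mul hfr hg, mul_assoc]
    congr 1
    nth_rewrite 1 [← ENNReal.rpow_one (∫⁻ y, g y ∂μ)]
    rw [← ENNReal.rpow_add_of_nonneg _ _ zero_le_one (by linarith)]
    simp

/-- For `1 ≤ q ≤ 2` the convolution of two `L^q` functions lies locally in `L^q`. -/
lemma eLpNorm_indicator_lintegral_sub_mul_le [SFinite μ] {f g : G → ℝ≥0∞} (hf : Measurable f)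
    (hg : Measurable g) {q : ℝ≥0∞} (hq : 1 ≤ q) (hq2 : q ≤ 2) {s : Set G}
    (hs : MeasurableSet s) :
    eLpNorm (s.indicator fun x => ∫⁻ y, f (x - y) * g y ∂μ) q μ ≤
      μ s ^ (1 - 1 / q.toReal) * eLpNorm f q μ * eLpNorm g q μ := by
  have hqt : q ≠ ∞ := ne_top_of_le_ne_top (by simp) hq2
  have hq0 : q ≠ 0 := (zero_lt_one.trans_le hq).ne'
  have hpos := ENNReal.toReal_pos hq0 hqt
  have hq1 : 1 ≤ q.toReal := by simpa using ENNReal.toReal_mono hqt hq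
  have hq2' : q.toReal ≤ 2 := by simpa using ENNReal.toReal_mono (by simp) hq2
  rw [eLpNorm_indicator_eq_eLpNorm_restrict hs, eLpNorm_le_iff_lintegral_rpow_le hq0 hqt,
    ENNReal.mul_rpow_of_nonneg _ _ hpos.le, ENNReal.mul_rpow_of_nonneg _ _ hpos.le,
    eLpNorm_rpow_toReal hq0 hqt, eLpNorm_rpow_toReal hq0 hqt, ← ENNReal.rpow_mul]
  set r := q.toReal
  have hr : r⁻¹ ≤ 1 := inv_le_one_of_one_le₀ hq1
  have hr2 : (2 : ℝ)⁻¹ ≤ r⁻¹ := inv_anti₀ hpos hq2'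
  have hfr : Measurable fun x => f x ^ r := hf.pow_const r
  have hgr : Measurable fun x => g x ^ r := hg.pow_const r
  set A := ∫⁻ x, f x ^ r ∂μ with hA
  set B := ∫⁻ x, g x ^ r ∂μ with hB
  set H : G → ℝ≥0∞ := fun x => ∫⁻ y, f (x - y) ^ r * g y ^ r ∂μ with hH
  have hHm : Measurable H := measurable_lintegral_sub_mul hfr hgr
  have hHi : ∫⁻ x, H x ∂μ = A * B := lintegral_lintegral_sub_mul hfr hgr
  have key : ∀ x, (∫⁻ y, f (x - y) * g y ∂μ) ^ r ≤ H x ^ (2 - r) * (A * B) ^ (r - 1) := by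
    intro x
    have h := ENNReal.lintegral_prod_norm_pow_le (μ := μ) (Finset.univ : Finset (Fin 3))
      (f := ![fun y => f (x - y) ^ r * g y ^ r, fun y => f (x - y) ^ r, fun y => g y ^ r])
      (p := ![2 * r⁻¹ - 1, 1 - r⁻¹, 1 - r⁻¹])
      (by
        intro i _
        fin_cases i
        · exact ((hfr.comp (measurable_const.sub measurable_id)).mul hgr).aemeasurable
        · exact (hfr.comp (measurable_const.sub measurable_id)).aemeasurable
        · exact hgr.aemeasurable)
      (by simp [Fin.sum_univ_three]; ring)
      (by
        intro i _
        fin_cases i <;> simp <;> linarith)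
    simp only [Fin.prod_univ_three, Matrix.cons_val_zero, Matrix.cons_val_one,
      Matrix.cons_val] at h
    rw [lintegral_sub_left_eq_self (fun y => f y ^ r) x] at h
    have h' : ∀ y, (f (x - y) ^ r * g y ^ r) ^ (2 * r⁻¹ - 1) * (f (x - y) ^ r) ^ (1 - r⁻¹) *
        (g y ^ r) ^ (1 - r⁻¹) = f (x - y) * g y := by
      intro y
      rw [ENNReal.mul_rpow_of_nonneg _ _ (by linarith), mul_assoc, mul_mul_mul_comm,
        ← ENNReal.rpow_add_of_nonneg _ _ (by linarith) (by linarith),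
        ← ENNReal.rpow_add_of_nonneg _ _ (by linarith) (by linarith),
        show 2 * r⁻¹ - 1 + (1 - r⁻¹) = r⁻¹ by ring, ENNReal.rpow_rpow_inv hpos.ne',
        ENNReal.rpow_rpow_inv hpos.ne']
    simp only [h'] at h
    refine (ENNReal.rpow_le_rpow h hpos.le).trans_eq ?_
    rw [ENNReal.mul_rpow_of_nonneg _ _ hpos.le, ENNReal.mul_rpow_of_nonneg _ _ hpos.le,
      ← ENNReal.rpow_mul, ← ENNReal.rpow_mul, ← ENNReal.rpow_mul,
      ENNReal.mul_rpow_of_nonneg _ _ (by linarith), ← mul_assoc,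
      show (2 * r⁻¹ - 1) * r = 2 - r by field_simp, show (1 - r⁻¹) * r = r - 1 by field_simp]
  calc ∫⁻ x in s, (∫⁻ y, f (x - y) * g y ∂μ) ^ r ∂μ
      ≤ ∫⁻ x in s, H x ^ (2 - r) * (A * B) ^ (r - 1) ∂μ := lintegral_mono key
    _ = (∫⁻ x in s, H x ^ (2 - r) * 1 ^ (r - 1) ∂μ) * (A * B) ^ (r - 1) := by
        simp only [ENNReal.one_rpow, mul_one]
        rw [lintegral_mul_const _ (hHm.pow_const _)]
    _ ≤ ((∫⁻ x in s, H x ∂μ) ^ (2 - r) * (∫⁻ x in s, 1 ∂μ) ^ (r - 1)) * (A * B) ^ (r - 1) := by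
        gcongr
        exact ENNReal.lintegral_mul_norm_pow_le hHm.aemeasurable aemeasurable_const
          (by linarith) (by linarith) (by ring)
    _ ≤ ((A * B) ^ (2 - r) * μ s ^ (r - 1)) * (A * B) ^ (r - 1) := by
        rw [← hHi]
        rw [setLIntegral_one]
        gcongr
        exact Measure.restrict_le_self
    _ = μ s ^ ((1 - 1 / r) * r) * A * B := by
        rw [mul_comm ((A * B) ^ (2 - r)), mul_assoc,
          ← ENNReal.rpow_add_of_nonneg _ _ (by linarith) (by linarith),
          show (1 - 1 / r) * r = r - 1 by field_simp, show 2 - r + (r - 1) = 1 by ring,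
          ENNReal.rpow_one, mul_assoc]

end Convolution

/-- A dyadic partition of unity, as `ℝ≥0∞`-valued functions. -/
structure IsDyadicPartition {E : Type*} [NormedAddCommGroup E] [MeasurableSpace E]
    (χ : ℤ → E → ℝ≥0∞) : Prop where
  measurable : ∀ j, Measurable (χ j)
  le_one : ∀ j ξ, χ j ξ ≤ 1
  norm_mem : ∀ j ξ, χ j ξ ≠ 0 → (2 : ℝ) ^ (j - 1) ≤ ‖ξ‖ ∧ ‖ξ‖ ≤ (2 : ℝ) ^ (j + 1)
  tsum_eq_one : ∀ ξ, ξ ≠ 0 → ∑' j, χ j ξ = 1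

lemma two_rpow_mul (x y : ℝ) : (2 : ℝ≥0∞) ^ x * 2 ^ y = 2 ^ (x + y) :=
  (ENNReal.rpow_add x y (by simp) (by simp)).symm

lemma two_rpow_ne_top (x : ℝ) : (2 : ℝ≥0∞) ^ x ≠ ∞ :=
  ENNReal.rpow_ne_top_of_ne_zero (by simp) (by simp)

lemma eLpNorm_le_of_support {α : Type*} [MeasurableSpace α] {μ : Measure α} {p q : ℝ≥0∞}
    (hpq : p ≤ q) {f : α → ℝ≥0∞} (hf : Measurable f) {s : Set α} (hs : MeasurableSet s)
    (hfs : ∀ x, f x ≠ 0 → x ∈ s) :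
    eLpNorm f p μ ≤ eLpNorm f q μ * μ s ^ (1 / p.toReal - 1 / q.toReal) := by
  have h : s.indicator f = f := Set.indicator_eq_self.2 hfs
  have h1 := eLpNorm_le_eLpNorm_mul_rpow_measure_univ (μ := μ.restrict s) hpq
    hf.aestronglyMeasurable
  rwa [← eLpNorm_indicator_eq_eLpNorm_restrict hs, ← eLpNorm_indicator_eq_eLpNorm_restrict hs, h,
    Measure.restrict_apply_univ] at h1

section Pieces

variable {E : Type*} [NormedAddCommGroup E]

variable (E) in
/-- The closed annulus `2^{m-2} ≤ |ξ| ≤ 2^{m+2}`. -/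
def annulus (m : ℤ) : Set E := {ξ | (2 : ℝ) ^ (m - 2) ≤ ‖ξ‖ ∧ ‖ξ‖ ≤ (2 : ℝ) ^ (m + 2)}

lemma mem_annulus {m : ℤ} {ξ : E} :
    ξ ∈ annulus E m ↔ (2 : ℝ) ^ (m - 2) ≤ ‖ξ‖ ∧ ‖ξ‖ ≤ (2 : ℝ) ^ (m + 2) := Iff.rfl

lemma mem_annulus_of_norm_sub_le {m : ℤ} {x η : E} (hx : (2 : ℝ) ^ (m - 1) ≤ ‖x‖)
    (hx' : ‖x‖ ≤ (2 : ℝ) ^ (m + 1)) (h : ‖x - η‖ ≤ (2 : ℝ) ^ (m - 2)) : η ∈ annulus E m := by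
  have h1 : (2 : ℝ) ^ (m - 1) = 2 * 2 ^ (m - 2) := by
    rw [← zpow_one_add₀ two_ne_zero]; ring_nf
  have h2 : (2 : ℝ) ^ (m + 1) = 8 * 2 ^ (m - 2) := by
    rw [show (8 : ℝ) = 2 ^ (3 : ℤ) by norm_num, ← zpow_add₀ two_ne_zero]; ring_nf
  have h3 : (2 : ℝ) ^ (m + 2) = 16 * 2 ^ (m - 2) := by
    rw [show (16 : ℝ) = 2 ^ (4 : ℤ) by norm_num, ← zpow_add₀ two_ne_zero]; ring_nf
  have hp : (0 : ℝ) < 2 ^ (m - 2) := by positivity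
  have h4 := norm_sub_norm_le x η
  have h5 := norm_sub_norm_le η x
  rw [norm_sub_rev] at h5
  exact mem_annulus.2 ⟨by linarith, by linarith⟩

variable [MeasurableSpace E]

lemma measurableSet_annulus [BorelSpace E] (m : ℤ) : MeasurableSet (annulus E m) :=
  (measurableSet_le measurable_const measurable_norm).inter
    (measurableSet_le measurable_norm measurable_const)

variable {χ : ℤ → E → ℝ≥0∞} (hχ : IsDyadicPartition χ)
include hχ

lemma indicator_annulus_le (m : ℤ) (g : E → ℝ≥0∞) (ξ : E) :
    (annulus E m).indicator g ξ ≤ ∑ l ∈ Finset.Icc (m - 3) (m + 3), χ l ξ * g ξ := by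
  by_cases h : ξ ∈ annulus E m
  · have h0 : ξ ≠ 0 := by
      rintro rfl
      have := (mem_annulus.1 h).1
      rw [norm_zero] at this
      exact absurd this (not_le.2 (by positivity))
    rw [Set.indicator_of_mem h, ← Finset.sum_mul]
    have h1 : ∑ l ∈ Finset.Icc (m - 3) (m + 3), χ l ξ = 1 := by
      refine Eq.trans (tsum_eq_sum fun l hl => ?_).symm (hχ.tsum_eq_one ξ h0)
      by_contra hne
      obtain ⟨h2, h3⟩ := hχ.norm_mem l ξ hne
      obtain ⟨h6, h7⟩ := mem_annulus.1 h
      have h4 : l - 1 ≤ m + 2 := by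
        have h8 := h2.trans h7
        rwa [zpow_le_zpow_iff_right₀ (_root_.one_lt_two : (1 : ℝ) < 2)] at h8
      have h5 : m - 2 ≤ l + 1 := by
        have h8 := h6.trans h3
        rwa [zpow_le_zpow_iff_right₀ (_root_.one_lt_two : (1 : ℝ) < 2)] at h8
      exact hl (Finset.mem_Icc.2 ⟨by linarith, by linarith⟩)
    rw [h1, one_mul]
  · simp [Set.indicator_of_notMem h]

lemma lintegral_localize {μ : Measure E} {f g : E → ℝ≥0∞} {j k : ℤ} (hjk : 3 ≤ |j - k|) (ξ : E) :
    χ j ξ * ∫⁻ η, χ k (ξ - η) * f (ξ - η) * g η ∂μ ≤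
      (Metric.closedBall 0 ((2 : ℝ) ^ (j + 1))).indicator (fun ξ => ∫⁻ η, χ k (ξ - η) * f (ξ - η) *
        (annulus E (max j k)).indicator g η ∂μ) ξ := by
  by_cases h : χ j ξ = 0
  · simp [h]
  obtain ⟨h1, h2⟩ := hχ.norm_mem j ξ h
  rw [Set.indicator_of_mem (by simpa using h2)]
  refine (mul_le_of_le_one_left' (hχ.le_one j ξ)).trans (lintegral_mono fun η => ?_)
  by_cases h' : χ k (ξ - η) = 0
  · simp [h']
  obtain ⟨h3, h4⟩ := hχ.norm_mem k _ h'
  rw [Set.indicator_of_mem]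
  rcases le_total j k with hle | hle
  · rw [abs_of_nonpos (by linarith)] at hjk
    rw [max_eq_right hle]
    have : -η ∈ annulus E k := by
      refine mem_annulus_of_norm_sub_le h3 h4 ?_
      rw [sub_neg_eq_add, sub_add_cancel]
      exact h2.trans (zpow_le_zpow_right₀ one_le_two (by linarith))
    simpa only [mem_annulus, norm_neg] using this
  · rw [abs_of_nonneg (by linarith)] at hjk
    rw [max_eq_left hle]
    exact mem_annulus_of_norm_sub_le h1 h2
      (h4.trans (zpow_le_zpow_right₀ one_le_two (by linarith)))

lemma eLpNorm_indicator_annulus_le [BorelSpace E] {μ : Measure E} {q M : ℝ≥0∞}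
    (hq : 1 ≤ q) {a : ℝ} (ha : 0 ≤ a) {g : E → ℝ≥0∞} (hg : Measurable g)
    (hM : ∀ k : ℤ, eLpNorm (fun ξ => χ k ξ * g ξ) q μ ≤ 2 ^ (-(a * k)) * M) (m : ℤ) :
    eLpNorm ((annulus E m).indicator g) q μ ≤ 7 * 2 ^ (3 * a) * 2 ^ (-(a * m)) * M := by
  have h1 : eLpNorm ((annulus E m).indicator g) q μ ≤
      eLpNorm (∑ l ∈ Finset.Icc (m - 3) (m + 3), fun ξ => χ l ξ * g ξ) q μ :=
    eLpNorm_mono_fun fun ξ => by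
      rw [Finset.sum_apply]
      exact indicator_annulus_le hχ m g ξ
  have h2 := eLpNorm_sum_le (μ := μ) (s := Finset.Icc (m - 3) (m + 3))
    (f := fun l ξ => χ l ξ * g ξ)
    (fun l _ => ((hχ.measurable l).mul hg).aestronglyMeasurable) hq
  refine h1.trans (h2.trans ?_)
  have h3 : ∀ l ∈ Finset.Icc (m - 3) (m + 3), eLpNorm (fun ξ => χ l ξ * g ξ) q μ ≤
      2 ^ (3 * a) * 2 ^ (-(a * m)) * M := by
    intro l hl
    refine (hM l).trans ?_
    rw [two_rpow_mul]
    gcongr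
    · norm_num
    · have : (m : ℝ) - 3 ≤ l := by exact_mod_cast (Finset.mem_Icc.1 hl).1
      nlinarith
  refine (Finset.sum_le_card_nsmul _ _ _ h3).trans_eq ?_
  rw [Int.card_Icc, show m + 3 + 1 - (m - 3) = 7 by ring, nsmul_eq_mul]
  rw [show (Int.toNat 7) = 7 from rfl, Nat.cast_ofNat]
  ring

omit hχ

variable [BorelSpace E] [NormedSpace ℝ E] [FiniteDimensional ℝ E] {μ : Measure E}
  [μ.IsAddHaarMeasure]

lemma measure_closedBall_two_zpow_rpow (m : ℤ) {t : ℝ} (ht : 0 ≤ t) :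
    μ (Metric.closedBall (0 : E) ((2 : ℝ) ^ m)) ^ t =
      2 ^ (Module.finrank ℝ E * t * m) * μ (Metric.ball (0 : E) 1) ^ t := by
  rw [Measure.addHaar_closedBall _ _ (by positivity), ENNReal.mul_rpow_of_nonneg _ _ ht]
  congr 1
  rw [← zpow_natCast, ← zpow_mul, ← Real.rpow_intCast,
    ← ENNReal.ofReal_rpow_of_pos two_pos, ENNReal.ofReal_ofNat, ← ENNReal.rpow_mul]
  congr 1
  push_cast
  ring

include hχ

/-- Comparable frequencies. -/
lemma eLpNorm_piece_le_near {q M : ℝ≥0∞} (hq : 1 ≤ q) {f g : E → ℝ≥0∞} (hf : Measurable f)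
    (hg : Measurable g) (hM : ∫⁻ η, g η ∂μ ≤ M) (j k : ℤ) :
    eLpNorm (fun ξ => χ j ξ * ∫⁻ η, χ k (ξ - η) * f (ξ - η) * g η ∂μ) q μ ≤
      eLpNorm (fun ξ => χ k ξ * f ξ) q μ * M := by
  refine (eLpNorm_mono_fun fun ξ => mul_le_of_le_one_left' (hχ.le_one j ξ)).trans ?_
  refine (eLpNorm_lintegral_sub_mul_le ((hχ.measurable k).mul hf) hg hq).trans ?_
  gcongr
  exact le_rfl

/-- High frequencies of `g` against low frequencies of `f`. -/
lemma eLpNorm_piece_le_low {q M : ℝ≥0∞} (hq : 1 ≤ q) {a : ℝ}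
    (ha : a = Module.finrank ℝ E * (1 - 1 / q.toReal)) (hu : 1 / q.toReal ≤ 1)
    {f g : E → ℝ≥0∞} (hf : Measurable f) (hg : Measurable g)
    (hM : ∀ k : ℤ, eLpNorm (fun ξ => χ k ξ * g ξ) q μ ≤ 2 ^ (-(a * k)) * M)
    {j k : ℤ} (hjk : k + 3 ≤ j) :
    eLpNorm (fun ξ => χ j ξ * ∫⁻ η, χ k (ξ - η) * f (ξ - η) * g η ∂μ) q μ ≤
      (7 * 2 ^ (3 * a) * 2 ^ a * μ (Metric.ball (0 : E) 1) ^ (1 - 1 / q.toReal)) *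
        2 ^ (a * (k - j)) * (eLpNorm (fun ξ => χ k ξ * f ξ) q μ * M) := by
  have ht : 0 ≤ 1 - 1 / q.toReal := by linarith
  have ha0 : 0 ≤ a := ha ▸ mul_nonneg (Nat.cast_nonneg _) ht
  have hfm : Measurable fun ξ => χ k ξ * f ξ := (hχ.measurable k).mul hf
  have hgm := hg.indicator (measurableSet_annulus (E := E) j)
  have h1 : eLpNorm (fun ξ => χ j ξ * ∫⁻ η, χ k (ξ - η) * f (ξ - η) * g η ∂μ) q μ ≤
      eLpNorm (fun ξ => ∫⁻ η, (annulus E j).indicator g (ξ - η) * (χ k η * f η) ∂μ) q μ := by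
    refine eLpNorm_mono_fun fun ξ => ?_
    refine (lintegral_localize hχ (by rw [abs_of_nonneg] <;> linarith) ξ).trans ?_
    rw [max_eq_left (by linarith)]
    refine (Set.indicator_le_self _ _ ξ).trans_eq ?_
    exact lintegral_sub_mul_comm (fun ξ => χ k ξ * f ξ) _ ξ
  refine h1.trans ((eLpNorm_lintegral_sub_mul_le hgm hfm hq).trans ?_)
  have h2 := eLpNorm_le_of_support (μ := μ) hq hfm
    (s := Metric.closedBall 0 ((2 : ℝ) ^ (k + 1))) measurableSet_closedBall
    (fun ξ hξ => by simpa using (hχ.norm_mem k ξ (left_ne_zero_of_mul hξ)).2)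
  rw [eLpNorm_one_eq_lintegral_enorm] at h2
  simp only [enorm_eq_self, ENNReal.toReal_one, one_div_one] at h2
  rw [measure_closedBall_two_zpow_rpow _ ht, ← ha] at h2
  refine (mul_le_mul' (eLpNorm_indicator_annulus_le hχ hq ha0 hg hM j) h2).trans_eq ?_
  have h3 : (2 : ℝ≥0∞) ^ (-(a * j)) * 2 ^ (a * ((k + 1 : ℤ) : ℝ)) = 2 ^ a * 2 ^ (a * (k - j)) := by
    rw [two_rpow_mul, two_rpow_mul]
    congr 1
    push_cast
    ring
  set N := eLpNorm (fun ξ => χ k ξ * f ξ) q μ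
  set V := μ (Metric.ball (0 : E) 1) ^ (1 - 1 / q.toReal)
  calc _ = 7 * 2 ^ (3 * a) * M * N * V * (2 ^ (-(a * j)) * 2 ^ (a * ((k + 1 : ℤ) : ℝ))) := by
        ring
    _ = _ := by
        rw [h3]
        ring

/-- High frequencies of `f` against high frequencies of `g`, for `q ≤ 2`. -/
lemma eLpNorm_piece_le_high_of_le_two {q M : ℝ≥0∞} (hq : 1 ≤ q) (hq2 : q ≤ 2) {a : ℝ}
    (ha : a = Module.finrank ℝ E * (1 - 1 / q.toReal)) (hu : 1 / q.toReal ≤ 1)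
    {f g : E → ℝ≥0∞} (hf : Measurable f) (hg : Measurable g)
    (hM : ∀ k : ℤ, eLpNorm (fun ξ => χ k ξ * g ξ) q μ ≤ 2 ^ (-(a * k)) * M)
    {j k : ℤ} (hjk : j + 3 ≤ k) :
    eLpNorm (fun ξ => χ j ξ * ∫⁻ η, χ k (ξ - η) * f (ξ - η) * g η ∂μ) q μ ≤
      (7 * 2 ^ (3 * a) * 2 ^ a * μ (Metric.ball (0 : E) 1) ^ (1 - 1 / q.toReal)) *
        2 ^ (a * (j - k)) * (eLpNorm (fun ξ => χ k ξ * f ξ) q μ * M) := by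
  have ht : 0 ≤ 1 - 1 / q.toReal := by linarith
  have ha0 : 0 ≤ a := ha ▸ mul_nonneg (Nat.cast_nonneg _) ht
  have hfm : Measurable fun ξ => χ k ξ * f ξ := (hχ.measurable k).mul hf
  have hgm := hg.indicator (measurableSet_annulus (E := E) k)
  have h1 := eLpNorm_mono_fun (μ := μ) (q := q) fun ξ =>
    lintegral_localize hχ (μ := μ) (f := f) (g := g) (j := j) (k := k)
      (by rw [abs_of_nonpos] <;> linarith) ξ
  rw [max_eq_right (by linarith)] at h1
  refine h1.trans ((eLpNorm_indicator_lintegral_sub_mul_le hfm hgm hq hq2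
    measurableSet_closedBall).trans ?_)
  rw [measure_closedBall_two_zpow_rpow _ ht, ← ha]
  refine (mul_le_mul_right (eLpNorm_indicator_annulus_le hχ hq ha0 hg hM k) _).trans_eq ?_
  have h3 : (2 : ℝ≥0∞) ^ (-(a * k)) * 2 ^ (a * ((j + 1 : ℤ) : ℝ)) = 2 ^ a * 2 ^ (a * (j - k)) := by
    rw [two_rpow_mul, two_rpow_mul]
    congr 1
    push_cast
    ring
  set N := eLpNorm (fun ξ => χ k ξ * f ξ) q μ
  set V := μ (Metric.ball (0 : E) 1) ^ (1 - 1 / q.toReal)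
  calc _ = 7 * 2 ^ (3 * a) * M * N * V * (2 ^ (-(a * k)) * 2 ^ (a * ((j + 1 : ℤ) : ℝ))) := by
        ring
    _ = _ := by
        rw [h3]
        ring

/-- High frequencies of `f` against high frequencies of `g`, for `q ≥ 2`. -/
lemma eLpNorm_piece_le_high_of_two_le {p q M : ℝ≥0∞} (hpq : 1 / p + 1 / q = 1) (hq2 : 2 ≤ q)
    (hp : p ≤ 2) {a : ℝ} (ha : a = Module.finrank ℝ E * (1 - 1 / q.toReal))
    (hp' : 1 / p.toReal = 1 - 1 / q.toReal) (hu : 1 / q.toReal ≤ 1 / 2)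
    {f g : E → ℝ≥0∞} (hf : Measurable f) (hg : Measurable g)
    (hM : ∀ k : ℤ, eLpNorm (fun ξ => χ k ξ * g ξ) q μ ≤ 2 ^ (-(a * k)) * M)
    {j k : ℤ} (hjk : j + 3 ≤ k) :
    eLpNorm (fun ξ => χ j ξ * ∫⁻ η, χ k (ξ - η) * f (ξ - η) * g η ∂μ) q μ ≤
      (7 * 2 ^ (3 * a) * 2 ^ (Module.finrank ℝ E * (2 - 3 * (1 / q.toReal))) *
        μ (Metric.ball (0 : E) 1) ^ (1 - 1 / q.toReal)) *
        2 ^ (Module.finrank ℝ E * (1 / q.toReal) * (j - k)) *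
        (eLpNorm (fun ξ => χ k ξ * f ξ) q μ * M) := by
  have hq : 1 ≤ q := le_trans (by norm_num) hq2
  have ht : 0 ≤ 1 - 1 / q.toReal := by linarith
  have ht' : 0 ≤ 1 - 1 / q.toReal - 1 / q.toReal := by linarith
  have hu0 : 0 ≤ 1 / q.toReal := by positivity
  have ha0 : 0 ≤ a := ha ▸ mul_nonneg (Nat.cast_nonneg _) ht
  have hfm : Measurable fun ξ => χ k ξ * f ξ := (hχ.measurable k).mul hf
  have hgm := hg.indicator (measurableSet_annulus (E := E) k)
  have h1 := eLpNorm_mono_fun (μ := μ) (q := q) fun ξ =>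
    lintegral_localize hχ (μ := μ) (f := f) (g := g) (j := j) (k := k)
      (by rw [abs_of_nonpos] <;> linarith) ξ
  rw [max_eq_right (by linarith)] at h1
  have h2 : ∀ ξ, ∫⁻ η, χ k (ξ - η) * f (ξ - η) * (annulus E k).indicator g η ∂μ ≤
      eLpNorm (fun ξ => χ k ξ * f ξ) q μ *
        eLpNorm ((annulus E k).indicator g) p μ := by
    intro ξ
    refine (lintegral_mul_le_eLpNorm_mul_eLpNorm hpq (ne_top_of_le_ne_top (by simp) hp)
      (f := fun η => χ k (ξ - η) * f (ξ - η))
      (hfm.comp (measurable_const.sub measurable_id)) hgm).trans_eq ?_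
    rw [← eLpNorm_sub_left hfm q ξ]
  have h3 := eLpNorm_le_of_support (μ := μ) (hp.trans hq2) hgm
    (s := Metric.closedBall 0 ((2 : ℝ) ^ (k + 2))) measurableSet_closedBall
    (fun ξ hξ => by simpa using (mem_annulus.1 (Set.mem_of_indicator_ne_zero hξ)).2)
  rw [hp', measure_closedBall_two_zpow_rpow _ ht'] at h3
  set N := eLpNorm (fun ξ => χ k ξ * f ξ) q μ
  set V := μ (Metric.ball (0 : E) 1)
  set c := N * (7 * 2 ^ (3 * a) * 2 ^ (-(a * k)) * M *
    (2 ^ (Module.finrank ℝ E * (1 - 1 / q.toReal - 1 / q.toReal) * ((k + 2 : ℤ) : ℝ)) *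
      V ^ (1 - 1 / q.toReal - 1 / q.toReal))) with hc
  have h4 : eLpNorm (fun ξ => χ j ξ * ∫⁻ η, χ k (ξ - η) * f (ξ - η) * g η ∂μ) q μ ≤
      eLpNorm ((Metric.closedBall (0 : E) ((2 : ℝ) ^ (j + 1))).indicator fun _ => c) q μ := by
    refine h1.trans (eLpNorm_mono_fun fun ξ => Set.indicator_le_indicator ((h2 ξ).trans ?_))
    rw [hc]
    gcongr
    refine h3.trans ?_
    gcongr
    exact eLpNorm_indicator_annulus_le hχ hq ha0 hg hM k
  have h5 := eLpNorm_le_of_support (μ := μ) (le_top : q ≤ ∞)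
    (f := (Metric.closedBall (0 : E) ((2 : ℝ) ^ (j + 1))).indicator fun _ => c)
    (measurable_const.indicator measurableSet_closedBall) measurableSet_closedBall
    (fun ξ hξ => Set.mem_of_indicator_ne_zero hξ)
  have h6 : eLpNorm ((Metric.closedBall (0 : E) ((2 : ℝ) ^ (j + 1))).indicator fun _ => c) ∞
      μ ≤ c := by
    rw [eLpNorm_exponent_top]
    refine essSup_le_of_ae_le _ (Filter.Eventually.of_forall fun ξ => ?_)
    exact Set.indicator_le_self _ _ ξ
  rw [ENNReal.toReal_top, _root_.div_zero, sub_zero] at h5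
  rw [measure_closedBall_two_zpow_rpow _ hu0] at h5
  refine h4.trans (h5.trans ((mul_le_mul_left h6 _).trans_eq ?_))
  have h7 : V ^ (1 - 1 / q.toReal) = V ^ (1 - 1 / q.toReal - 1 / q.toReal) * V ^ (1 / q.toReal) := by
    rw [← ENNReal.rpow_add_of_nonneg _ _ ht' hu0, sub_add_cancel]
  have h8 : (2 : ℝ≥0∞) ^ (-(a * k)) * (2 ^ (Module.finrank ℝ E * (1 - 1 / q.toReal - 1 / q.toReal) *
      ((k + 2 : ℤ) : ℝ)) * 2 ^ (Module.finrank ℝ E * (1 / q.toReal) * ((j + 1 : ℤ) : ℝ))) =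
      2 ^ (Module.finrank ℝ E * (2 - 3 * (1 / q.toReal))) *
        2 ^ (Module.finrank ℝ E * (1 / q.toReal) * (j - k)) := by
    rw [two_rpow_mul, two_rpow_mul, two_rpow_mul, ha]
    congr 1
    push_cast
    ring
  rw [hc, h7]
  calc _ = 7 * 2 ^ (3 * a) * M * N *
        (V ^ (1 - 1 / q.toReal - 1 / q.toReal) * V ^ (1 / q.toReal)) *
        (2 ^ (-(a * k)) * (2 ^ (Module.finrank ℝ E * (1 - 1 / q.toReal - 1 / q.toReal) *
          ((k + 2 : ℤ) : ℝ)) * 2 ^ (Module.finrank ℝ E * (1 / q.toReal) * ((j + 1 : ℤ) : ℝ)))) := by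
        ring
    _ = _ := by
        rw [h8]
        ring

/-- Off-diagonal decay of the frequency-localised pieces of a convolution. -/
lemma exists_weighted_piece_le {p q : ℝ≥0∞} (hpq : 1 / p + 1 / q = 1) {s : ℝ}
    (hs : (2 ≤ p ∧ |s| < Module.finrank ℝ E * (1 / p).toReal) ∨
      (p < 2 ∧ -(Module.finrank ℝ E * (1 / q).toReal) < s ∧
        s < Module.finrank ℝ E * (1 / p).toReal)) :
    ∃ ε : ℝ, 0 < ε ∧ ∃ K : ℝ≥0∞, K ≠ ∞ ∧ ∀ (f g : E → ℝ≥0∞) (M : ℝ≥0∞), Measurable f →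
      Measurable g → ∫⁻ η, g η ∂μ ≤ M →
      (∀ k : ℤ, 2 ^ (Module.finrank ℝ E * (1 / p).toReal * k) *
        eLpNorm (fun ξ => χ k ξ * g ξ) q μ ≤ M) →
      ∀ j k : ℤ, 2 ^ (s * j) *
        eLpNorm (fun ξ => χ j ξ * ∫⁻ η, χ k (ξ - η) * f (ξ - η) * g η ∂μ) q μ ≤
        K * 2 ^ (-(ε * (|j - k| : ℤ))) * M * (2 ^ (s * k) * eLpNorm (fun ξ => χ k ξ * f ξ) q μ) := by
  have hq : 1 ≤ q := by
    rw [← ENNReal.inv_le_one, ← one_div]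
    exact le_add_self.trans_eq hpq
  have hp1 : 1 ≤ p := by
    rw [← ENNReal.inv_le_one, ← one_div]
    exact le_self_add.trans_eq hpq
  have hu : (1 / p).toReal + (1 / q).toReal = 1 := by
    rw [← ENNReal.toReal_add (by simp; rintro rfl; simp at hp1) (by simp; rintro rfl; simp at hq),
      hpq, ENNReal.toReal_one]
  have hp' : (1 / p).toReal = 1 / p.toReal := by rw [one_div, ENNReal.toReal_inv, one_div]
  have hq' : (1 / q).toReal = 1 / q.toReal := by rw [one_div, ENNReal.toReal_inv, one_div]
  have hp0 : 0 ≤ (1 / p).toReal := ENNReal.toReal_nonneg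
  have ha : Module.finrank ℝ E * (1 / p).toReal = Module.finrank ℝ E * (1 - 1 / q.toReal) := by
    rw [← hq', ← hu, add_sub_cancel_right]
  have hV : ∀ t : ℝ, 0 ≤ t → μ (Metric.ball (0 : E) 1) ^ t ≠ ∞ := fun t ht =>
    ENNReal.rpow_ne_top_of_nonneg ht measure_ball_lt_top.ne
  set a := Module.finrank ℝ E * (1 / p).toReal with ha_def
  obtain ⟨b, K₀, hK₀, hsa, hsb, hhigh⟩ : ∃ (b : ℝ) (K₀ : ℝ≥0∞), K₀ ≠ ∞ ∧ s < a ∧ -b < s ∧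
      ∀ (f g : E → ℝ≥0∞) (M : ℝ≥0∞), Measurable f → Measurable g →
      (∀ k : ℤ, eLpNorm (fun ξ => χ k ξ * g ξ) q μ ≤ 2 ^ (-(a * k)) * M) →
      ∀ j k : ℤ, j + 3 ≤ k →
        eLpNorm (fun ξ => χ j ξ * ∫⁻ η, χ k (ξ - η) * f (ξ - η) * g η ∂μ) q μ ≤
        K₀ * 2 ^ (b * (j - k)) * (eLpNorm (fun ξ => χ k ξ * f ξ) q μ * M) := by
    rcases hs with ⟨hp2, hs⟩ | ⟨hp2, hs1, hs2⟩
    · have hq2 : q ≤ 2 := by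
        by_contra! h
        have h1 : 1 / p + 1 / q < 2⁻¹ + 2⁻¹ := by
          rw [one_div, one_div]
          exact ENNReal.add_lt_add_of_le_of_lt (by simp; rintro rfl; simp at hp1)
            (ENNReal.inv_le_inv.2 hp2) (ENNReal.inv_lt_inv.2 h)
        rw [hpq, ENNReal.inv_two_add_inv_two] at h1
        exact h1.false
      obtain ⟨h1, h2⟩ := abs_lt.1 hs
      exact ⟨a, _, by
        refine ENNReal.mul_ne_top (ENNReal.mul_ne_top (ENNReal.mul_ne_top (by simp)
          (two_rpow_ne_top _)) (two_rpow_ne_top _)) (hV _ (by linarith)), h2, h1,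
        fun f g M hf hg hM j k hjk => eLpNorm_piece_le_high_of_le_two hχ hq hq2 ha
          (by linarith) hf hg hM hjk⟩
    · have hq2 : 2 ≤ q := by
        by_contra! h
        have h1 : 2⁻¹ + 2⁻¹ < 1 / p + 1 / q := by
          rw [one_div, one_div]
          exact ENNReal.add_lt_add_of_le_of_lt (by simp)
            (ENNReal.inv_le_inv.2 hp2.le) (ENNReal.inv_lt_inv.2 h)
        rw [hpq, ENNReal.inv_two_add_inv_two] at h1
        exact h1.false
      have hu2 : (1 / q).toReal ≤ 1 / 2 := by
        have := ENNReal.toReal_mono (by simp) (ENNReal.inv_le_inv.2 hq2)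
        rw [one_div]
        simpa using this
      exact ⟨Module.finrank ℝ E * (1 / q.toReal), _, by
        refine ENNReal.mul_ne_top (ENNReal.mul_ne_top (ENNReal.mul_ne_top (by simp)
          (two_rpow_ne_top _)) (two_rpow_ne_top _)) (hV _ (by linarith)), hs2, hq' ▸ hs1,
        fun f g M hf hg hM j k hjk => eLpNorm_piece_le_high_of_two_le hχ hpq hq2 hp2.le ha
          (by linarith) (by linarith) hf hg hM hjk⟩
  set K₁ : ℝ≥0∞ := 7 * 2 ^ (3 * a) * 2 ^ a * μ (Metric.ball (0 : E) 1) ^ (1 - 1 / q.toReal)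
    with hK₁
  have hK₁t : K₁ ≠ ∞ := ENNReal.mul_ne_top (ENNReal.mul_ne_top (ENNReal.mul_ne_top (by simp)
    (two_rpow_ne_top _)) (two_rpow_ne_top _)) (hV _ (by linarith))
  set ε := min (a - s) (s + b)
  have hε1 : ε ≤ a - s := min_le_left _ _
  have hε2 : ε ≤ s + b := min_le_right _ _
  have hε : 0 < ε := lt_min (by linarith) (by linarith)
  refine ⟨ε, hε, K₀ + K₁ + 2 ^ (2 * |s| + 2 * ε), by
    simp [hK₀, hK₁t], fun f g M hf hg hM1 hM2 j k => ?_⟩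
  have hM : ∀ k : ℤ, eLpNorm (fun ξ => χ k ξ * g ξ) q μ ≤ 2 ^ (-(a * k)) * M := by
    intro k
    calc _ = 2 ^ (-(a * k)) * (2 ^ (a * k) * eLpNorm (fun ξ => χ k ξ * g ξ) q μ) := by
          rw [← mul_assoc, two_rpow_mul, neg_add_cancel, ENNReal.rpow_zero, one_mul]
      _ ≤ _ := by gcongr; exact hM2 k
  set N := eLpNorm (fun ξ => χ k ξ * f ξ) q μ
  have key : ∀ (L : ℝ≥0∞) (x : ℝ), L ≤ K₀ + K₁ + 2 ^ (2 * |s| + 2 * ε) →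
      s * j + x ≤ -(ε * (|j - k| : ℤ)) + s * k →
      2 ^ (s * j) * (L * 2 ^ x * (N * M)) ≤
        (K₀ + K₁ + 2 ^ (2 * |s| + 2 * ε)) * 2 ^ (-(ε * (|j - k| : ℤ))) * M * (2 ^ (s * k) * N) := by
    intro L x hL hx
    calc _ = L * (2 ^ (s * j) * 2 ^ x) * (M * N) := by ring
      _ ≤ (K₀ + K₁ + 2 ^ (2 * |s| + 2 * ε)) * (2 ^ (-(ε * (|j - k| : ℤ))) * 2 ^ (s * k)) *
          (M * N) := by
          rw [two_rpow_mul, two_rpow_mul]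
          gcongr
          norm_num
      _ = _ := by ring
  rcases le_or_gt (k + 3) j with hjk | hjk
  · refine (mul_le_mul_right (eLpNorm_piece_le_low hχ hq ha (by linarith) hf hg hM hjk) _).trans
      (key _ _ (le_add_right le_add_self) ?_)
    have h : (k : ℝ) + 3 ≤ j := by exact_mod_cast hjk
    rw [abs_of_nonneg (by linarith)]
    push_cast
    nlinarith
  rcases le_or_gt (j + 3) k with hjk' | hjk'
  · refine (mul_le_mul_right (hhigh f g M hf hg hM j k hjk') _).trans
      (key _ _ (le_add_right le_self_add) ?_)
    have h : (j : ℝ) + 3 ≤ k := by exact_mod_cast hjk'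
    rw [abs_of_nonpos (by linarith)]
    push_cast
    nlinarith
  · have h : |(j : ℝ) - k| ≤ 2 := by
      have : |j - k| ≤ 2 := abs_le.2 ⟨by linarith, by linarith⟩
      exact_mod_cast this
    refine (mul_le_mul_right (eLpNorm_piece_le_near hχ hq hf hg hM1 j k) _).trans ?_
    have := key (2 ^ (2 * |s| + 2 * ε)) (-(2 * |s| + 2 * ε)) le_add_self (by
      push_cast
      have h1 : s * (j - k) ≤ |s| * 2 := (le_abs_self _).trans (by
        rw [abs_mul]; gcongr)
      nlinarith)
    rwa [two_rpow_mul, add_neg_cancel, ENNReal.rpow_zero, one_mul] at this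

omit hχ

omit [BorelSpace E] [NormedSpace ℝ E] [FiniteDimensional ℝ E] [μ.IsAddHaarMeasure] in
lemma lintegral_sub_mul_eq_tsum [MeasurableSub E] [NullSingletonClass μ] (hχ : IsDyadicPartition χ)
    {f g : E → ℝ≥0∞} (hf : Measurable f) (hg : Measurable g) (ξ : E) :
    ∫⁻ η, f (ξ - η) * g η ∂μ = ∑' k, ∫⁻ η, χ k (ξ - η) * f (ξ - η) * g η ∂μ := by
  rw [← lintegral_tsum]
  · refine lintegral_congr_ae ?_
    filter_upwards [compl_mem_ae_iff.2 (measure_singleton ξ)] with η hη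
    simp only [mul_assoc]
    rw [ENNReal.tsum_mul_right, hχ.tsum_eq_one _ (sub_ne_zero.2 fun h => hη h.symm), one_mul]
  · intro k
    exact ((((hχ.measurable k).mul hf).comp (measurable_const_sub ξ)).mul hg).aemeasurable

end Pieces

section Sequences

lemma seqLp_eq_eLpNorm {σ : ℝ≥0∞} (hσ : σ ≠ 0) (a : ℤ → ℝ≥0∞) :
    seqLp σ a = eLpNorm a σ Measure.count := by
  rw [seqLp]
  split_ifs with h
  · subst h
    simp [eLpNormEssSup]
  · rw [eLpNorm_eq_lintegral_rpow hσ h, lintegral_count]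

lemma seqLp_mono {σ : ℝ≥0∞} {a b : ℤ → ℝ≥0∞} (h : ∀ j, a j ≤ b j) : seqLp σ a ≤ seqLp σ b := by
  rw [seqLp, seqLp]
  split_ifs
  · exact iSup_mono h
  · gcongr with j
    exact h j

/-- Young's inequality `ℓ^1 * ℓ^σ ⊆ ℓ^σ`. -/
lemma seqLp_tsum_sub_mul_le {σ : ℝ≥0∞} (hσ : 1 ≤ σ) (w a : ℤ → ℝ≥0∞) :
    seqLp σ (fun j => ∑' k, w (j - k) * a k) ≤ (∑' n, w n) * seqLp σ a := by
  have hσ0 : σ ≠ 0 := (zero_lt_one.trans_le hσ).ne'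
  rw [seqLp_eq_eLpNorm hσ0, seqLp_eq_eLpNorm hσ0, ← lintegral_count, mul_comm]
  simp only [← lintegral_count]
  simp only [lintegral_sub_mul_comm w a]
  exact eLpNorm_lintegral_sub_mul_le measurable_from_top measurable_from_top hσ

lemma tsum_two_rpow_neg_abs_ne_top {ε : ℝ} (hε : 0 < ε) :
    ∑' n : ℤ, (2 : ℝ≥0∞) ^ (-(ε * (|n| : ℤ))) ≠ ∞ := by
  have h : Summable fun n : ℤ => (2 : ℝ) ^ (-(ε * (|n| : ℤ))) := by
    have h0 : Summable fun n : ℕ => ((2 : ℝ) ^ (-ε)) ^ n :=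
      summable_geometric_of_lt_one (by positivity)
        (Real.rpow_lt_one_of_one_lt_of_neg (_root_.one_lt_two) (by linarith))
    have h1 : (fun n : ℕ => ((2 : ℝ) ^ (-ε)) ^ n) = fun n : ℕ => (2 : ℝ) ^ (-(ε * n)) := by
      ext n
      rw [← Real.rpow_natCast, ← Real.rpow_mul (by norm_num), neg_mul]
    rw [h1] at h0
    exact Summable.of_nat_of_neg (by simpa using h0) (by simpa using h0)
  have h2 := h.tsum_ofReal_ne_top
  simpa only [← ENNReal.ofReal_rpow_of_pos two_pos, ENNReal.ofReal_ofNat] using h2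

end Sequences

section Product

variable {E : Type*} [NormedAddCommGroup E] [MeasurableSpace E] [BorelSpace E] [NormedSpace ℝ E]
  [FiniteDimensional ℝ E] {μ : Measure E} [μ.IsAddHaarMeasure] [NullSingletonClass μ]

/-- The product estimate for nonnegative functions. -/
theorem exists_seqLp_convolution_le {χ : ℤ → E → ℝ≥0∞} (hχ : IsDyadicPartition χ)
    {p q σ : ℝ≥0∞} (hpq : 1 / p + 1 / q = 1) (hσ : 1 ≤ σ) {s : ℝ}
    (hs : (2 ≤ p ∧ |s| < Module.finrank ℝ E * (1 / p).toReal) ∨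
      (p < 2 ∧ -(Module.finrank ℝ E * (1 / q).toReal) < s ∧
        s < Module.finrank ℝ E * (1 / p).toReal)) :
    ∃ C : ℝ≥0∞, C ≠ ∞ ∧ ∀ f g : E → ℝ≥0∞, Measurable f → Measurable g →
      seqLp σ (fun j => 2 ^ (s * j) *
        eLpNorm (fun ξ => χ j ξ * ∫⁻ η, f (ξ - η) * g η ∂μ) q μ) ≤
      C * seqLp σ (fun j => 2 ^ (s * j) * eLpNorm (fun ξ => χ j ξ * f ξ) q μ) *
        (∫⁻ η, g η ∂μ + ⨆ k : ℤ, 2 ^ (Module.finrank ℝ E * (1 / p).toReal * k) *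
          eLpNorm (fun ξ => χ k ξ * g ξ) q μ) := by
  have hq : 1 ≤ q := by
    rw [← ENNReal.inv_le_one, ← one_div]
    exact le_add_self.trans_eq hpq
  obtain ⟨ε, hε, K, hK, h⟩ := exists_weighted_piece_le (μ := μ) hχ hpq hs
  refine ⟨K * ∑' n : ℤ, (2 : ℝ≥0∞) ^ (-(ε * (|n| : ℤ))),
    ENNReal.mul_ne_top hK (tsum_two_rpow_neg_abs_ne_top hε), fun f g hf hg => ?_⟩
  set M := ∫⁻ η, g η ∂μ + ⨆ k : ℤ, 2 ^ (Module.finrank ℝ E * (1 / p).toReal * k) *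
    eLpNorm (fun ξ => χ k ξ * g ξ) q μ with hM
  have h' := h f g M hf hg le_self_add fun k => le_add_left (le_iSup (fun k : ℤ =>
    (2 : ℝ≥0∞) ^ (Module.finrank ℝ E * (1 / p).toReal * k) *
      eLpNorm (fun ξ => χ k ξ * g ξ) q μ) k)
  refine (seqLp_mono fun j => ?_).trans ((seqLp_tsum_sub_mul_le hσ
    (fun n => K * 2 ^ (-(ε * (|n| : ℤ))) * M)
    fun j => 2 ^ (s * j) * eLpNorm (fun ξ => χ j ξ * f ξ) q μ).trans_eq ?_)
  · refine le_trans ?_ (ENNReal.tsum_le_tsum fun k => h' j k)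
    rw [ENNReal.tsum_mul_left]
    gcongr
    refine le_trans (le_of_eq ?_) (eLpNorm_tsum_le hq fun k => (hχ.measurable j).mul
      (measurable_lintegral_sub_mul ((hχ.measurable k).mul hf) hg))
    congr 1
    ext ξ
    rw [lintegral_sub_mul_eq_tsum hχ hf hg, ENNReal.tsum_mul_left]
  · rw [ENNReal.tsum_mul_right, ENNReal.tsum_mul_left]
    ring

end Product

section Complex

variable {E : Type*} [NormedAddCommGroup E] [MeasurableSpace E] [BorelSpace E] [NormedSpace ℝ E]

lemma isDyadicPartition_of_dilates {ψ : E → ℝ} (hψm : Measurable ψ)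
    (hψ01 : ∀ ξ, ψ ξ ∈ Set.Icc (0 : ℝ) 1)
    (hψsupp : ∀ ξ, ψ ξ ≠ 0 → 1 / 2 ≤ ‖ξ‖ ∧ ‖ξ‖ ≤ 2)
    (hψsum : ∀ ξ : E, ξ ≠ 0 → ∑' j : ℤ, ψ ((2 : ℝ) ^ (-j) • ξ) = 1) :
    IsDyadicPartition fun (j : ℤ) ξ => ENNReal.ofReal (ψ ((2 : ℝ) ^ (-j) • ξ)) where
  measurable j := (hψm.comp (measurable_const_smul _)).ennreal_ofReal
  le_one j ξ := ENNReal.ofReal_le_one.2 (hψ01 _).2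
  norm_mem j ξ h := by
    have h0 : ψ ((2 : ℝ) ^ (-j) • ξ) ≠ 0 := fun h0 => h (by rw [h0, ENNReal.ofReal_zero])
    obtain ⟨h1, h2⟩ := hψsupp _ h0
    have hp : (0 : ℝ) < 2 ^ j := by positivity
    rw [norm_smul, norm_zpow, Real.norm_ofNat, zpow_neg, ← div_eq_inv_mul] at h1 h2
    rw [div_le_div_iff₀ two_pos hp] at h1
    rw [div_le_iff₀ hp] at h2
    rw [zpow_sub_one₀ two_ne_zero, zpow_add_one₀ two_ne_zero]
    constructor <;> linarith
  tsum_eq_one ξ hξ := by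
    have h := hψsum ξ hξ
    have hs : Summable fun j : ℤ => ψ ((2 : ℝ) ^ (-j) • ξ) := by
      by_contra hs
      rw [tsum_eq_zero_of_not_summable hs] at h
      exact zero_ne_one h
    rw [← ENNReal.ofReal_tsum_of_nonneg (fun j => (hψ01 _).1) hs, h, ENNReal.ofReal_one]

variable {μ : Measure E}

omit [BorelSpace E] in
lemma eLpNorm_dilate_smul {ψ : E → ℝ} (hψ01 : ∀ ξ, ψ ξ ∈ Set.Icc (0 : ℝ) 1) (q : ℝ≥0∞)
    {F : E → ℂ} {f : E → ℝ≥0∞} (hf : ∀ᵐ ξ ∂μ, ‖F ξ‖ₑ = f ξ) (j : ℤ) :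
    eLpNorm (fun ξ => ψ ((2 : ℝ) ^ (-j) • ξ) • F ξ) q μ =
      eLpNorm (fun ξ => ENNReal.ofReal (ψ ((2 : ℝ) ^ (-j) • ξ)) * f ξ) q μ := by
  refine eLpNorm_congr_enorm_ae ?_
  filter_upwards [hf] with ξ hξ
  rw [enorm_smul, hξ, enorm_eq_self, Real.enorm_of_nonneg (hψ01 _).1]

lemma enorm_integral_sub_mul_le [FiniteDimensional ℝ E] [μ.IsAddHaarMeasure] {F G : E → ℂ}
    {f g : E → ℝ≥0∞} (hf : ∀ᵐ ξ ∂μ, ‖F ξ‖ₑ = f ξ) (hg : ∀ᵐ ξ ∂μ, ‖G ξ‖ₑ = g ξ) (ξ : E) :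
    ‖∫ η, F (ξ - η) * G η ∂μ‖ₑ ≤ ∫⁻ η, f (ξ - η) * g η ∂μ := by
  refine (enorm_integral_le_lintegral_enorm _).trans_eq (lintegral_congr_ae ?_)
  filter_upwards [(Measure.measurePreserving_sub_left μ ξ).quasiMeasurePreserving.ae hf, hg]
    with η h1 h2
  rw [enorm_mul, h1, h2]

lemma ofReal_two_rpow (x : ℝ) : ENNReal.ofReal ((2 : ℝ) ^ x) = 2 ^ x := by
  rw [← ENNReal.ofReal_rpow_of_pos two_pos, ENNReal.ofReal_ofNat]

/-- The product estimate for integrable complex-valued functions. -/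
theorem exists_seqLp_integral_convolution_le [FiniteDimensional ℝ E] [μ.IsAddHaarMeasure]
    [NullSingletonClass μ] {ψ : E → ℝ} (hψm : Measurable ψ)
    (hψ01 : ∀ ξ, ψ ξ ∈ Set.Icc (0 : ℝ) 1)
    (hψsupp : ∀ ξ, ψ ξ ≠ 0 → 1 / 2 ≤ ‖ξ‖ ∧ ‖ξ‖ ≤ 2)
    (hψsum : ∀ ξ : E, ξ ≠ 0 → ∑' j : ℤ, ψ ((2 : ℝ) ^ (-j) • ξ) = 1)
    {p q σ : ℝ≥0∞} (hpq : 1 / p + 1 / q = 1) (hσ : 1 ≤ σ) {s : ℝ}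
    (hs : (2 ≤ p ∧ |s| < Module.finrank ℝ E * (1 / p).toReal) ∨
      (p < 2 ∧ -(Module.finrank ℝ E * (1 / q).toReal) < s ∧
        s < Module.finrank ℝ E * (1 / p).toReal)) :
    ∃ C > 0, ∀ F G : E → ℂ, Integrable F μ → Integrable G μ →
      seqLp σ (fun j => ENNReal.ofReal ((2 : ℝ) ^ (s * (j : ℝ))) *
        eLpNorm (fun ξ => ψ ((2 : ℝ) ^ (-j) • ξ) • ∫ η, F (ξ - η) * G η ∂μ) q μ) ≤
        ENNReal.ofReal C * seqLp σ (fun j => ENNReal.ofReal ((2 : ℝ) ^ (s * (j : ℝ))) *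
          eLpNorm (fun ξ => ψ ((2 : ℝ) ^ (-j) • ξ) • F ξ) q μ) *
          (eLpNorm G 1 μ + ⨆ k : ℤ,
            ENNReal.ofReal ((2 : ℝ) ^ (Module.finrank ℝ E * (1 / p).toReal * (k : ℝ))) *
              eLpNorm (fun ξ => ψ ((2 : ℝ) ^ (-k) • ξ) • G ξ) q μ) := by
  obtain ⟨C, hC, h⟩ := exists_seqLp_convolution_le (μ := μ)
    (isDyadicPartition_of_dilates hψm hψ01 hψsupp hψsum) hpq hσ hs
  refine ⟨C.toReal + 1, by positivity, fun F G hF hG => ?_⟩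
  have hf : ∀ᵐ ξ ∂μ, ‖F ξ‖ₑ = ‖hF.1.mk F ξ‖ₑ := by
    filter_upwards [hF.1.ae_eq_mk] with ξ hξ
    rw [← hξ]
  have hg : ∀ᵐ ξ ∂μ, ‖G ξ‖ₑ = ‖hG.1.mk G ξ‖ₑ := by
    filter_upwards [hG.1.ae_eq_mk] with ξ hξ
    rw [← hξ]
  have h1 := h _ _ hF.1.stronglyMeasurable_mk.measurable.enorm
    hG.1.stronglyMeasurable_mk.measurable.enorm
  simp only [ofReal_two_rpow, eLpNorm_dilate_smul hψ01 q hf, eLpNorm_dilate_smul hψ01 q hg,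
    eLpNorm_one_eq_lintegral_enorm]
  rw [lintegral_congr_ae hg]
  refine (seqLp_mono fun j => ?_).trans (h1.trans ?_)
  · gcongr
    refine eLpNorm_mono_enorm fun ξ => ?_
    rw [enorm_smul, enorm_eq_self, Real.enorm_of_nonneg (hψ01 _).1]
    gcongr
    exact enorm_integral_sub_mul_le hf hg ξ
  · gcongr
    exact (ENNReal.le_ofReal_iff_toReal_le hC (by positivity)).2 (by linarith)

end Complex

end FourierBesov

/-- Fourier-side product estimate: for `|s| < d/p` if `p ≥ 2`, and `-d/p' < s < d/p` if
`1 ≤ p < 2` (conjugacy `1/p + 1/p' = 1` in `ℝ≥0∞` encodes `1 ≤ p ≤ ∞`; `d/p` is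
`d·(1/p).toReal`), there is `C > 0` such that for `F, G ∈ L¹`,
`‖F∗G‖_{\widehat{\dot B}^s_{p,σ}} ≤ C ‖F‖_{\widehat{\dot B}^s_{p,σ}}
  (‖G‖_{L¹} + sup_k 2^{(d/p)k} ‖ψ_k G‖_{L^{p'}})`, the Fourier-side form of
`‖fg‖_{\widehat{\dot B}^s_{p,σ}} ≲ ‖f‖_{\widehat{\dot B}^s_{p,σ}}
  ‖g‖_{\widehat L^∞ ∩ \widehat{\dot B}^{d/p}_{p,∞}}`. -/
theorem stmt19 (d : ℕ) (hd : 1 ≤ d) (p p' σ : ℝ≥0∞) (hpc : 1 / p + 1 / p' = 1) (hσ : 1 ≤ σ)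
    (s : ℝ)
    (hs : (2 ≤ p ∧ |s| < (d : ℝ) * (1 / p).toReal) ∨
      (p < 2 ∧ -((d : ℝ) * (1 / p').toReal) < s ∧ s < (d : ℝ) * (1 / p).toReal))
    (ψ : EuclideanSpace ℝ (Fin d) → ℝ) (hψm : Measurable ψ)
    (hψ01 : ∀ ξ, ψ ξ ∈ Set.Icc (0 : ℝ) 1)
    (hψsupp : ∀ ξ, ψ ξ ≠ 0 → 1 / 2 ≤ ‖ξ‖ ∧ ‖ξ‖ ≤ 2)
    (hψsum : ∀ ξ : EuclideanSpace ℝ (Fin d), ξ ≠ 0 → ∑' j : ℤ, ψ ((2 : ℝ) ^ (-j) • ξ) = 1) :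
    ∃ C > 0, ∀ F G : EuclideanSpace ℝ (Fin d) → ℂ, Integrable F → Integrable G →
      fbNorm d ψ s p' σ (fun ξ => ∫ η, F (ξ - η) * G η) ≤
        ENNReal.ofReal C * fbNorm d ψ s p' σ F *
          (eLpNorm G 1 volume +
            ⨆ k : ℤ, ENNReal.ofReal ((2 : ℝ) ^ ((d : ℝ) * (1 / p).toReal * (k : ℝ))) *
              eLpNorm (fun ξ => ψ ((2 : ℝ) ^ (-k) • ξ) • G ξ) p' volume) := by
  have : Nonempty (Fin d) := ⟨⟨0, hd⟩⟩
  have h := FourierBesov.exists_seqLp_integral_convolution_le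
    (μ := (volume : Measure (EuclideanSpace ℝ (Fin d)))) hψm hψ01 hψsupp hψsum hpc hσ (s := s)
    (by rwa [finrank_euclideanSpace_fin])
  rw [finrank_euclideanSpace_fin] at h
  exact h
end
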